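/- arXiv:math/0703808 — 2 statements merged into one kernel-verified Lean document; each statement's English description precedes it below -/
import Mathlib

section
/- Let n ≥ 3 and let f : [0,∞) → ℝ be a continuous function such that s ↦ s^{−(n+2)/(n−2)} f(s) is strictly decreasing on (0,∞). If v ∈ C²(S^n) is positive and satisfies −Δ_{S^n} v + (n(n−2)/4) v = f(v) on S^n, then v is a constant function, v ≡ c, where the constant c > 0 satisfies f(c) = (n(n−2)/4) c. -/
open scoped BigOperators

/-- The Euclidean Laplacian of `u : ℝᵐ → ℝ` at `x`, as the sum of the pure second
derivatives in the standard coordinate directions. -/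
noncomputable def eLaplacian {m : ℕ} (u : EuclideanSpace ℝ (Fin m) → ℝ)
    (x : EuclideanSpace ℝ (Fin m)) : ℝ :=
  ∑ i : Fin m, iteratedFDeriv ℝ 2 u x ![EuclideanSpace.single i 1, EuclideanSpace.single i 1]

/-- The Laplace–Beltrami operator on the unit sphere: apply the Euclidean Laplacian to the
degree-zero homogeneous extension `x ↦ v (x/|x|)` and evaluate at a point of the sphere. -/
noncomputable def sphLaplacian {m : ℕ} (v : EuclideanSpace ℝ (Fin m) → ℝ)
    (θ : EuclideanSpace ℝ (Fin m)) : ℝ :=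
  eLaplacian (fun x => v (‖x‖⁻¹ • x)) θ

section MovingPlanes

open Filter Topology

/-- `h` is differentiable near `t` with `h' t = d₁`, and `h'` has derivative `d₂` at `t`. -/
def HasSecondDerivAt (h : ℝ → ℝ) (d₁ d₂ t : ℝ) : Prop :=
  ∃ h' : ℝ → ℝ, (∀ᶠ x in 𝓝 t, HasDerivAt h (h' x) x) ∧ h' t = d₁ ∧ HasDerivAt h' d₂ t

namespace HasSecondDerivAt

variable {g h : ℝ → ℝ} {c₁ c₂ d₁ d₂ t : ℝ}

theorem sub (hg : HasSecondDerivAt g c₁ c₂ t) (hh : HasSecondDerivAt h d₁ d₂ t) :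
    HasSecondDerivAt (fun x => g x - h x) (c₁ - d₁) (c₂ - d₂) t := by
  obtain ⟨g', hg, rfl, hg'⟩ := hg
  obtain ⟨h', hh, rfl, hh'⟩ := hh
  exact ⟨fun x => g' x - h' x, by filter_upwards [hg, hh] with x h1 h2 using h1.sub h2, rfl,
    hg'.sub hh'⟩

theorem mul (hg : HasSecondDerivAt g c₁ c₂ t) (hh : HasSecondDerivAt h d₁ d₂ t) :
    HasSecondDerivAt (fun x => g x * h x) (c₁ * h t + g t * d₁)
      (c₂ * h t + 2 * c₁ * d₁ + g t * d₂) t := by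
  obtain ⟨g', hg, rfl, hg'⟩ := hg
  obtain ⟨h', hh, rfl, hh'⟩ := hh
  refine ⟨fun x => g' x * h x + g x * h' x,
    by filter_upwards [hg, hh] with x h1 h2 using h1.mul h2, rfl, ?_⟩
  exact ((hg'.mul hh.self_of_nhds).add (hg.self_of_nhds.mul hh')).congr_deriv (by ring)

theorem const (c t : ℝ) : HasSecondDerivAt (fun _ => c) 0 0 t :=
  ⟨fun _ => 0, .of_forall fun x => hasDerivAt_const x c, rfl, hasDerivAt_const t 0⟩

theorem const_mul (c : ℝ) (hh : HasSecondDerivAt h d₁ d₂ t) :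
    HasSecondDerivAt (fun x => c * h x) (c * d₁) (c * d₂) t := by
  simpa using (const c t).mul hh

theorem comp_const_sub (a : ℝ) (hh : HasSecondDerivAt h d₁ d₂ (a - t)) :
    HasSecondDerivAt (fun x => h (a - x)) (-d₁) d₂ t := by
  obtain ⟨h', hh, rfl, hh'⟩ := hh
  have hc : Tendsto (fun x => a - x) (𝓝 t) (𝓝 (a - t)) :=
    (continuous_const.sub continuous_id).tendsto t
  refine ⟨fun x => -h' (a - x), ?_, rfl, ?_⟩
  · filter_upwards [hc.eventually hh] with x hx using hx.comp_const_sub a x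
  · exact (hh'.comp_const_sub a t).neg.congr_deriv (neg_neg _)

theorem nonneg_of_isLocalMin (hh : HasSecondDerivAt h d₁ d₂ t) (hmin : IsLocalMin h t) :
    0 ≤ d₂ := by
  obtain ⟨h', hh, -, hh'⟩ := hh
  by_contra! hd
  have hderiv : deriv h =ᶠ[𝓝 t] h' := by filter_upwards [hh] with x hx using hx.deriv
  have hdd : deriv (deriv h) t = d₂ := by rw [hderiv.deriv_eq, hh'.deriv]
  have hmax := isLocalMax_of_deriv_deriv_neg (by rwa [hdd]) hmin.deriv_eq_zero
    hh.self_of_nhds.continuousAt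
  have hconst : h =ᶠ[𝓝 t] fun _ => h t := by
    filter_upwards [hmin, hmax] with x h1 h2 using le_antisymm h2 h1
  have : deriv (deriv h) t = 0 := by
    rw [hconst.deriv.deriv_eq]; simp
  linarith

theorem comp_curve {E : Type*} [NormedAddCommGroup E] [NormedSpace ℝ E] {V : E → ℝ}
    {c c' : ℝ → E} {c'' : E} (hV : ContDiffAt ℝ 2 V (c t))
    (hc : ∀ x, HasDerivAt c (c' x) x) (hc' : HasDerivAt c' c'' t) :
    HasSecondDerivAt (fun x => V (c x)) (fderiv ℝ V (c t) (c' t))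
      (fderiv ℝ (fderiv ℝ V) (c t) (c' t) (c' t) + fderiv ℝ V (c t) c'') t := by
  have hd : ∀ᶠ z in 𝓝 (c t), DifferentiableAt ℝ V z := by
    filter_upwards [hV.eventually (by simp)] with z hz using hz.differentiableAt (by simp)
  have hV' : DifferentiableAt ℝ (fderiv ℝ V) (c t) :=
    (hV.fderiv_right (m := 1) (by norm_num)).differentiableAt (by simp)
  refine ⟨fun x => fderiv ℝ V (c x) (c' x), ?_, rfl, ?_⟩
  · filter_upwards [(hc t).continuousAt.eventually hd] with x hx
    exact hx.hasFDerivAt.comp_hasDerivAt x (hc x)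
  · exact (hV'.hasFDerivAt.comp_hasDerivAt t (hc t)).clm_apply hc'

theorem cosh_rpow (a t : ℝ) :
    HasSecondDerivAt (fun x => Real.cosh x ^ (-a))
      (-a * Real.cosh t ^ (-a) * (Real.sinh t / Real.cosh t))
      (Real.cosh t ^ (-a) * (a ^ 2 - a * (a + 1) / Real.cosh t ^ 2)) t := by
  have hp (x : ℝ) (b : ℝ) : HasDerivAt (fun x => Real.cosh x ^ b)
      (Real.sinh x * b * Real.cosh x ^ (b - 1)) x :=
    (Real.hasDerivAt_cosh x).rpow_const (Or.inl (Real.cosh_pos x).ne')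
  have hsub (b : ℝ) : Real.cosh t ^ (b - 1) = Real.cosh t ^ b / Real.cosh t := by
    rw [Real.rpow_sub_one (Real.cosh_pos t).ne']
  have hne := (Real.cosh_pos t).ne'
  refine ⟨_, .of_forall fun x => hp x (-a), ?_, ?_⟩
  · rw [hsub]; ring
  · refine (((Real.hasDerivAt_sinh t).mul_const (-a)).mul (hp t (-a - 1))).congr_deriv ?_
    rw [hsub (-a - 1), hsub (-a)]
    field_simp
    rw [Real.sinh_sq]
    ring

end HasSecondDerivAt

section Homogeneous

variable {E : Type*} [NormedAddCommGroup E] [NormedSpace ℝ E] {V : E → ℝ}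

theorem fderiv_self_eq_zero_of_homogeneous (hh : ∀ c : ℝ, 0 < c → ∀ x, V (c • x) = V x) {x : E}
    (hx : DifferentiableAt ℝ V x) : fderiv ℝ V x x = 0 := by
  have h1 : HasDerivAt (fun c : ℝ => c • x) x 1 := by
    simpa using (hasDerivAt_id (1 : ℝ)).smul_const x
  have h2 : HasDerivAt (fun c : ℝ => V (c • x)) (fderiv ℝ V x x) 1 := by
    refine HasFDerivAt.comp_hasDerivAt (1 : ℝ) ?_ h1
    simpa using hx.hasFDerivAt
  have h3 : (fun c : ℝ => V (c • x)) =ᶠ[𝓝 1] fun _ => V x := by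
    filter_upwards [lt_mem_nhds (zero_lt_one (α := ℝ))] with c hc using hh c hc x
  exact h2.unique ((hasDerivAt_const _ _).congr_of_eventuallyEq h3)

theorem fderiv_fderiv_self_of_homogeneous (hh : ∀ c : ℝ, 0 < c → ∀ x, V (c • x) = V x) {x : E}
    (hx : ContDiffAt ℝ 2 V x) (w : E) :
    fderiv ℝ (fderiv ℝ V) x w x = -fderiv ℝ V x w := by
  have hV' : DifferentiableAt ℝ (fderiv ℝ V) x :=
    (hx.fderiv_right (m := 1) (by norm_num)).differentiableAt (by simp)
  have h1 : HasFDerivAt (fun z => fderiv ℝ V z z) _ x :=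
    hV'.hasFDerivAt.clm_apply (hasFDerivAt_id x)
  have h2 : (fun z => fderiv ℝ V z z) =ᶠ[𝓝 x] fun _ => 0 := by
    filter_upwards [hx.eventually (by simp)] with z hz
    exact fderiv_self_eq_zero_of_homogeneous hh (hz.differentiableAt (by simp))
  have h3 := congrArg (fun L => L w)
    (h1.unique ((hasFDerivAt_const (0 : ℝ) x).congr_of_eventuallyEq h2))
  simp at h3
  linarith

end Homogeneous

section Cylinder

variable {E : Type*} [NormedAddCommGroup E] [InnerProductSpace ℝ E] {V : E → ℝ} {e y b : E}

/-- The degree-zero homogeneous function `V`, read on the cylinder `ℝ × eᗮ` through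
`(t, y) ↦ y + sinh t • e` and weighted by the conformal factor `cosh t ^ (-a)`. -/
noncomputable def cylinderFun (a : ℝ) (V : E → ℝ) (e : E) (t : ℝ) (y : E) : ℝ :=
  Real.cosh t ^ (-a) * V (y + Real.sinh t • e)

/-- The point of the sphere with cylinder coordinates `(t, y)`. -/
noncomputable def cylinderPoint (e : E) (t : ℝ) (y : E) : E :=
  (Real.cosh t)⁻¹ • (y + Real.sinh t • e)

theorem norm_add_sinh_smul (he : ‖e‖ = 1) (hy : ‖y‖ = 1) (hey : inner ℝ e y = 0) (t : ℝ) :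
    ‖y + Real.sinh t • e‖ = Real.cosh t := by
  have h : ‖y + Real.sinh t • e‖ ^ 2 = Real.cosh t ^ 2 := by
    rw [norm_add_sq_real, inner_smul_right, real_inner_comm, hey, norm_smul, hy, he, Real.cosh_sq]
    simp; ring
  exact (pow_left_inj₀ (norm_nonneg _) (Real.cosh_pos t).le two_ne_zero).1 h

theorem norm_cylinderPoint (he : ‖e‖ = 1) (hy : ‖y‖ = 1) (hey : inner ℝ e y = 0) (t : ℝ) :
    ‖cylinderPoint e t y‖ = 1 := by
  rw [cylinderPoint, norm_smul, norm_add_sinh_smul he hy hey, norm_inv, Real.norm_eq_abs,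
    abs_of_pos (Real.cosh_pos t), inv_mul_cancel₀ (Real.cosh_pos t).ne']

theorem apply_cylinderPoint (hh : ∀ c : ℝ, 0 < c → ∀ x, V (c • x) = V x) (t : ℝ) (y : E) :
    V (cylinderPoint e t y) = V (y + Real.sinh t • e) :=
  hh _ (inv_pos.2 (Real.cosh_pos t)) _

theorem hasSecondDerivAt_axial (hh : ∀ c : ℝ, 0 < c → ∀ x, V (c • x) = V x) {t : ℝ}
    (hV : ContDiffAt ℝ 2 V (cylinderPoint e t y)) :
    HasSecondDerivAt (fun x => V (y + Real.sinh x • e))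
      (fderiv ℝ V (cylinderPoint e t y) e)
      (fderiv ℝ (fderiv ℝ V) (cylinderPoint e t y) e e
        + Real.sinh t / Real.cosh t * fderiv ℝ V (cylinderPoint e t y) e) t := by
  have hne := (Real.cosh_pos t).ne'
  have hc (x : ℝ) : HasDerivAt (fun x => (Real.cosh t)⁻¹ • (y + Real.sinh x • e))
      ((Real.cosh t)⁻¹ • (Real.cosh x • e)) x :=
    (((Real.hasDerivAt_sinh x).smul_const e).const_add y).const_smul _
  have hc' : HasDerivAt (fun x => (Real.cosh t)⁻¹ • (Real.cosh x • e))
      ((Real.cosh t)⁻¹ • (Real.sinh t • e)) t :=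
    ((Real.hasDerivAt_cosh t).smul_const e).const_smul _
  have h := HasSecondDerivAt.comp_curve (V := V) hV hc hc'
  have hf : (fun x => V ((Real.cosh t)⁻¹ • (y + Real.sinh x • e)))
      = fun x => V (y + Real.sinh x • e) :=
    funext fun x => hh _ (inv_pos.2 (Real.cosh_pos t)) _
  rw [hf, inv_smul_smul₀ hne, smul_smul, map_smul, smul_eq_mul, inv_mul_eq_div] at h
  exact h

theorem hasSecondDerivAt_angular (hh : ∀ c : ℝ, 0 < c → ∀ x, V (c • x) = V x) {t : ℝ}
    (hV : ContDiffAt ℝ 2 V (cylinderPoint e t y)) :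
    HasSecondDerivAt (fun α => V (Real.cos α • y + Real.sin α • b + Real.sinh t • e))
      ((Real.cosh t)⁻¹ * fderiv ℝ V (cylinderPoint e t y) b)
      ((Real.cosh t)⁻¹ ^ 2 * fderiv ℝ (fderiv ℝ V) (cylinderPoint e t y) b b
        + Real.sinh t / Real.cosh t * fderiv ℝ V (cylinderPoint e t y) e) 0 := by
  have hne := (Real.cosh_pos t).ne'
  have hc (x : ℝ) : HasDerivAt
      (fun α => (Real.cosh t)⁻¹ • (Real.cos α • y + Real.sin α • b + Real.sinh t • e))
      ((Real.cosh t)⁻¹ • ((-Real.sin x) • y + Real.cos x • b)) x :=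
    ((((Real.hasDerivAt_cos x).smul_const y).add
      ((Real.hasDerivAt_sin x).smul_const b)).add_const _).const_smul _
  have hc' : HasDerivAt (fun x => (Real.cosh t)⁻¹ • ((-Real.sin x) • y + Real.cos x • b))
      ((Real.cosh t)⁻¹ • ((-Real.cos 0) • y + (-Real.sin 0) • b)) 0 :=
    (((Real.hasDerivAt_sin 0).neg.smul_const y).add
      ((Real.hasDerivAt_cos 0).smul_const b)).const_smul _
  have h0 : (Real.cosh t)⁻¹ • (Real.cos 0 • y + Real.sin 0 • b + Real.sinh t • e)
      = cylinderPoint e t y := by simp [cylinderPoint]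
  have h := HasSecondDerivAt.comp_curve (V := V) (h0 ▸ hV) hc hc'
  have hf : (fun α => V ((Real.cosh t)⁻¹ • (Real.cos α • y + Real.sin α • b + Real.sinh t • e)))
      = fun α => V (Real.cos α • y + Real.sin α • b + Real.sinh t • e) :=
    funext fun x => hh _ (inv_pos.2 (Real.cosh_pos t)) _
  rw [hf, h0] at h
  have hrad := fderiv_self_eq_zero_of_homogeneous hh (hV.differentiableAt (by simp))
  have hexp : fderiv ℝ V (cylinderPoint e t y) (cylinderPoint e t y) =
      (Real.cosh t)⁻¹ * (fderiv ℝ V (cylinderPoint e t y) y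
        + Real.sinh t * fderiv ℝ V (cylinderPoint e t y) e) := by
    conv_lhs => rw [show fderiv ℝ V (cylinderPoint e t y) (cylinderPoint e t y)
      = fderiv ℝ V (cylinderPoint e t y) ((Real.cosh t)⁻¹ • (y + Real.sinh t • e)) from rfl]
    simp
    ring
  rw [hexp] at hrad
  convert h using 1
  · simp
  · simp
    linear_combination hrad

end Cylinder

section Laplacian

variable {n : ℕ} {V : EuclideanSpace ℝ (Fin (n + 1)) → ℝ}

theorem eLaplacian_eq_sum_orthonormalBasis {m : ℕ} (u : EuclideanSpace ℝ (Fin m) → ℝ)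
    (b : OrthonormalBasis (Fin m) ℝ (EuclideanSpace ℝ (Fin m))) (x : EuclideanSpace ℝ (Fin m)) :
    eLaplacian u x = ∑ i, fderiv ℝ (fderiv ℝ u) x (b i) (b i) := by
  have h1 := congrFun (InnerProductSpace.laplacian_eq_iteratedFDeriv_orthonormalBasis u
    (EuclideanSpace.basisFun (Fin m) ℝ)) x
  have h2 := congrFun (InnerProductSpace.laplacian_eq_iteratedFDeriv_orthonormalBasis u b) x
  simp only [EuclideanSpace.basisFun_apply] at h1
  rw [eLaplacian, ← h1, h2]
  simp [iteratedFDeriv_two_apply]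

/-- The Laplacian of the cylinder, expressed through second derivatives along the coordinate
curves, in terms of the Laplacian of the homogeneous function. -/
theorem exists_cylinder_laplacian (hh : ∀ c : ℝ, 0 < c → ∀ x, V (c • x) = V x)
    (hV : ∀ x ≠ 0, ContDiffAt ℝ 2 V x)
    (b : OrthonormalBasis (Fin (n + 1)) ℝ (EuclideanSpace ℝ (Fin (n + 1))))
    {i j : Fin (n + 1)} (hij : i ≠ j) {a : ℝ} (ha : 2 * a = n - 2) (t : ℝ) :
    ∃ (d d' : ℝ) (D D' : Fin (n + 1) → ℝ),
      HasSecondDerivAt (fun x => cylinderFun a V (b i) x (b j)) d d' t ∧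
      (∀ k, HasSecondDerivAt
        (fun α => cylinderFun a V (b i) t (Real.cos α • b j + Real.sin α • b k)) (D k) (D' k) 0) ∧
      d' + ∑ k ∈ {i, j}ᶜ, D' k = a ^ 2 * cylinderFun a V (b i) t (b j)
        + Real.cosh t ^ (-a) / Real.cosh t ^ 2 * (eLaplacian V (cylinderPoint (b i) t (b j))
          - a * (a + 1) * V (cylinderPoint (b i) t (b j))) := by
  have hne := (Real.cosh_pos t).ne'
  have horth : inner ℝ (b i) (b j) = 0 := b.orthonormal.2 hij
  have hθ0 : cylinderPoint (b i) t (b j) ≠ 0 := by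
    rw [← norm_ne_zero_iff, norm_cylinderPoint (b.norm_eq_one i) (b.norm_eq_one j) horth]
    exact one_ne_zero
  have hVθ := hV _ hθ0
  refine ⟨_, _, _, _, (HasSecondDerivAt.cosh_rpow a t).mul (hasSecondDerivAt_axial hh hVθ),
    fun k => (hasSecondDerivAt_angular hh hVθ).const_mul _, ?_⟩
  rw [eLaplacian_eq_sum_orthonormalBasis V b, ← Finset.sum_add_sum_compl {i, j},
    Finset.sum_pair hij, ← Finset.mul_sum, Finset.sum_add_distrib, ← Finset.mul_sum,
    Finset.sum_const, Finset.card_compl, Finset.card_pair hij, Fintype.card_fin, cylinderFun,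
    ← apply_cylinderPoint hh t (b j)]
  have hsymm := (hVθ.isSymmSndFDerivAt (by simp)) (b i) (b j)
  have hrad := fderiv_self_eq_zero_of_homogeneous hh (hVθ.differentiableAt (by simp))
  have hrad2 := fderiv_fderiv_self_of_homogeneous hh hVθ
  have hexp (L : EuclideanSpace ℝ (Fin (n + 1)) →L[ℝ] ℝ) : L (cylinderPoint (b i) t (b j)) =
      (Real.cosh t)⁻¹ * (L (b j) + Real.sinh t * L (b i)) := by
    simp [cylinderPoint]
    ring
  have hri := hrad2 (b i)
  have hrj := hrad2 (b j)
  rw [hexp] at hrad hri hrj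
  have hn : ((n + 1 - 2 : ℕ) : ℝ) = 2 * a + 1 := by
    have : 2 ≤ n + 1 := by
      have := i.2; have := j.2
      rcases Nat.lt_or_ge n 1 with h | h
      · exact absurd (Fin.ext (by omega)) hij
      · omega
    rw [Nat.cast_sub this, ha]; push_cast; ring
  rw [nsmul_eq_mul, hn]
  clear hexp hrad2 hθ0
  generalize cylinderPoint (b i) t (b j) = θ at *
  generalize ∑ k ∈ {i, j}ᶜ, fderiv ℝ (fderiv ℝ V) θ (b k) (b k) = S
  generalize fderiv ℝ (fderiv ℝ V) θ (b i) (b i) = Dii at *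
  generalize fderiv ℝ (fderiv ℝ V) θ (b j) (b j) = Djj at *
  rw [hsymm] at hri
  generalize fderiv ℝ (fderiv ℝ V) θ (b j) (b i) = Dji at *
  generalize fderiv ℝ V θ (b i) = Di at *
  generalize fderiv ℝ V θ (b j) = Dj at *
  generalize V θ = v
  have hs := Real.cosh_sq t
  generalize Real.cosh t ^ (-a) = w
  generalize Real.cosh t = c at *
  generalize Real.sinh t = s at *
  have h1 : Dj = -(s * Di) := by
    field_simp at hrad; linarith
  have h2 : Dji = -(c * Di) - s * Dii := by
    field_simp at hri; linarith
  subst h1 h2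
  have h3 : Djj = 2 * s * c * Di + s ^ 2 * Dii := by
    field_simp at hrj; linarith
  subst h3
  field_simp
  linear_combination w * Dii * hs

end Laplacian

section Equation

open Real Set

/-- `V` is the degree-zero homogeneous extension of a positive `C²` solution on the unit sphere of
`-Δ v + n (n - 2) / 4 * v = f v`, where `s ^ (-(n + 2) / (n - 2)) * f s` is strictly decreasing. -/
structure IsConformalSolution (n : ℕ) (f : ℝ → ℝ)
    (V : EuclideanSpace ℝ (Fin (n + 1)) → ℝ) : Prop where
  strictAntiOn : StrictAntiOn (fun s : ℝ => s ^ (-(((n : ℝ) + 2) / ((n : ℝ) - 2))) * f s) (Ioi 0)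
  homogeneous : ∀ c : ℝ, 0 < c → ∀ x, V (c • x) = V x
  contDiffAt : ∀ x ≠ 0, ContDiffAt ℝ 2 V x
  pos : ∀ x ≠ 0, 0 < V x
  equation : ∀ θ, ‖θ‖ = 1 → -eLaplacian V θ + (n * ((n : ℝ) - 2) / 4) * V θ = f (V θ)

/-- The unit sphere of the orthogonal complement of `e`. -/
def equator {E : Type*} [NormedAddCommGroup E] [InnerProductSpace ℝ E] (e : E) : Set E :=
  {y | ‖y‖ = 1 ∧ inner ℝ e y = 0}

theorem isCompact_equator {E : Type*} [NormedAddCommGroup E] [InnerProductSpace ℝ E]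
    [FiniteDimensional ℝ E] (e : E) : IsCompact (equator e) := by
  have : equator e = Metric.sphere 0 1 ∩ {y | inner ℝ e y = 0} := by
    ext y; simp [equator]
  rw [this]
  exact (isCompact_sphere 0 1).inter_right (isClosed_eq (by fun_prop) continuous_const)

theorem exists_orthonormalBasis_pair {n : ℕ} {i j : Fin (n + 1)} (hij : i ≠ j)
    {e y : EuclideanSpace ℝ (Fin (n + 1))} (he : ‖e‖ = 1) (hy : y ∈ equator e) :
    ∃ b : OrthonormalBasis (Fin (n + 1)) ℝ (EuclideanSpace ℝ (Fin (n + 1))),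
      b i = e ∧ b j = y := by
  have hv : Orthonormal ℝ (({i, j} : Set (Fin (n + 1))).domRestrict
      (fun k => if k = i then e else y)) := by
    constructor
    · rintro ⟨k, rfl | rfl⟩
      · simpa using he
      · simpa [hij.symm] using hy.1
    · rintro ⟨k, rfl | rfl⟩ ⟨l, rfl | rfl⟩ hkl
      · simp at hkl
      · simpa [hij.symm] using hy.2
      · simpa [hij.symm, real_inner_comm] using hy.2
      · simp at hkl
  obtain ⟨b, hb⟩ := hv.exists_orthonormalBasis_extension_of_card_eq (by simp)
  refine ⟨b, ?_, ?_⟩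
  · simpa using hb i (by simp)
  · simpa [hij.symm] using hb j (by simp)

theorem abs_le_cosh (t : ℝ) : |t| ≤ cosh t := by
  rw [← cosh_abs]
  exact (self_le_sinh_iff.2 (abs_nonneg t)).trans (sinh_lt_cosh _).le

theorem rpow_sub_rpow_le {p A B : ℝ} (hp : 1 ≤ p) (hA : 0 < A) (hB : 0 < B) :
    B ^ p - A ^ p ≤ p * B ^ (p - 1) * (B - A) := by
  have h := one_add_mul_self_le_rpow_one_add (s := A / B - 1)
    (by have := div_pos hA hB; linarith) hp
  rw [add_sub_cancel, div_rpow hA.le hB.le, le_div_iff₀ (rpow_pos_of_pos hB p)] at h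
  rw [rpow_sub_one hB.ne']
  have : (1 + p * (A / B - 1)) * B ^ p = B ^ p - p * (B ^ p / B) * (B - A) := by
    field_simp
    ring
  linarith

namespace IsConformalSolution

variable {n : ℕ} {f : ℝ → ℝ} {V : EuclideanSpace ℝ (Fin (n + 1)) → ℝ}
  {e y : EuclideanSpace ℝ (Fin (n + 1))}

theorem add_sinh_smul_ne_zero (he : ‖e‖ = 1) (hy : y ∈ equator e) (t : ℝ) :
    y + sinh t • e ≠ 0 := by
  rw [← norm_ne_zero_iff, norm_add_sinh_smul he hy.1 hy.2]
  exact (cosh_pos t).ne'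

theorem continuousOn_cylinderFun (h : IsConformalSolution n f V) (he : ‖e‖ = 1) (a : ℝ) :
    ContinuousOn (fun q : ℝ × EuclideanSpace ℝ (Fin (n + 1)) => cylinderFun a V e q.1 q.2)
      {q | q.2 ∈ equator e} := by
  refine ContinuousOn.mul ?_ ?_
  · refine ContinuousOn.rpow_const (by fun_prop) fun q _ => Or.inl (cosh_pos _).ne'
  · have hV : ContinuousOn V {x | x ≠ 0} := fun x hx =>
      (h.contDiffAt x hx).continuousAt.continuousWithinAt
    exact hV.comp (by fun_prop) fun q hq => add_sinh_smul_ne_zero he hq q.1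

theorem continuousOn_cylinderFun_sub (h : IsConformalSolution n f V) (he : ‖e‖ = 1) (a : ℝ) :
    ContinuousOn (fun q : ℝ × ℝ × EuclideanSpace ℝ (Fin (n + 1)) =>
      cylinderFun a V e q.2.1 q.2.2 - cylinderFun a V e (2 * q.1 - q.2.1) q.2.2)
      {q | q.2.2 ∈ equator e} := by
  have hU := h.continuousOn_cylinderFun he a
  refine ContinuousOn.sub ?_ ?_
  · exact hU.comp (f := fun q : ℝ × ℝ × EuclideanSpace ℝ (Fin (n + 1)) => (q.2.1, q.2.2))
      (by fun_prop) fun q hq => hq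
  · exact hU.comp
      (f := fun q : ℝ × ℝ × EuclideanSpace ℝ (Fin (n + 1)) => (2 * q.1 - q.2.1, q.2.2))
      (by fun_prop) fun q hq => hq

theorem exists_bounds (h : IsConformalSolution n f V) :
    ∃ m M : ℝ, 0 < m ∧ 0 < M ∧ ∀ x ≠ 0, m ≤ V x ∧ V x ≤ M := by
  have hc : ContinuousOn V (Metric.sphere 0 1) := fun x hx =>
    (h.contDiffAt x (ne_zero_of_mem_unit_sphere ⟨x, hx⟩)).continuousAt.continuousWithinAt
  have hne : (Metric.sphere (0 : EuclideanSpace ℝ (Fin (n + 1))) 1).Nonempty :=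
    NormedSpace.sphere_nonempty.2 zero_le_one
  obtain ⟨x₁, hx₁, h₁⟩ := (isCompact_sphere _ _).exists_isMinOn hne hc
  obtain ⟨x₂, hx₂, h₂⟩ := (isCompact_sphere _ _).exists_isMaxOn hne hc
  refine ⟨V x₁, V x₂, h.pos _ (ne_zero_of_mem_unit_sphere ⟨x₁, hx₁⟩),
    h.pos _ (ne_zero_of_mem_unit_sphere ⟨x₂, hx₂⟩), fun x hx => ?_⟩
  have hx' : ‖x‖⁻¹ • x ∈ Metric.sphere (0 : EuclideanSpace ℝ (Fin (n + 1))) 1 := by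
    simp [norm_smul, hx]
  rw [← h.homogeneous _ (inv_pos.2 (norm_pos_iff.2 hx)) x]
  exact ⟨h₁ hx', h₂ hx'⟩

/-- The equation at a minimum point of the difference of the solution, its reflection across
`t = s` and a barrier `ψ`. -/
theorem le_of_touching (h : IsConformalSolution n f V) (hn : 3 ≤ n) {a p s t : ℝ}
    (ha : 2 * a = n - 2) (hp : p = ((n : ℝ) + 2) / ((n : ℝ) - 2))
    (he : ‖e‖ = 1) (hy : y ∈ equator e) {ψ : ℝ → ℝ} {ψ₁ ψ₂ : ℝ}
    (hψ : HasSecondDerivAt ψ ψ₁ ψ₂ t)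
    (h0 : ψ t = cylinderFun a V e t y - cylinderFun a V e (2 * s - t) y)
    (ht : ∀ᶠ x in 𝓝 t, ψ x ≤ cylinderFun a V e x y - cylinderFun a V e (2 * s - x) y)
    (hz : ∀ z ∈ equator e, ψ t ≤ cylinderFun a V e t z - cylinderFun a V e (2 * s - t) z) :
    ψ₂ ≤ a ^ 2 * (cylinderFun a V e t y - cylinderFun a V e (2 * s - t) y)
      + cylinderFun a V e (2 * s - t) y ^ p *
        (V (y + sinh (2 * s - t) • e) ^ (-p) * f (V (y + sinh (2 * s - t) • e)))
      - cylinderFun a V e t y ^ p * (V (y + sinh t • e) ^ (-p) * f (V (y + sinh t • e))) := by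
  have hn' : (3 : ℝ) ≤ n := by exact_mod_cast hn
  have hij : (0 : Fin (n + 1)) ≠ Fin.last n := by
    intro h0; have := congrArg Fin.val h0; simp at this; omega
  obtain ⟨b, rfl, rfl⟩ := exists_orthonormalBasis_pair hij he hy
  obtain ⟨d₁, d₁', D₁, D₁', hd₁, hD₁, hsum₁⟩ :=
    exists_cylinder_laplacian h.homogeneous h.contDiffAt b hij ha t
  obtain ⟨d₂, d₂', D₂, D₂', hd₂, hD₂, hsum₂⟩ :=
    exists_cylinder_laplacian h.homogeneous h.contDiffAt b hij ha (2 * s - t)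
  have haxial : 0 ≤ d₁' - d₂' - ψ₂ := by
    refine ((hd₁.sub hd₂.comp_const_sub).sub hψ).nonneg_of_isLocalMin ?_
    filter_upwards [ht] with x hx
    linarith
  have hang (k : Fin (n + 1)) (hk : k ∈ ({0, Fin.last n} : Finset (Fin (n + 1)))ᶜ) :
      0 ≤ D₁' k - D₂' k := by
    simp only [Finset.mem_compl, Finset.mem_insert, Finset.mem_singleton, not_or] at hk
    refine ((hD₁ k).sub (hD₂ k)).nonneg_of_isLocalMin (.of_forall fun α => ?_)
    have hmem : cos α • b (Fin.last n) + sin α • b k ∈ equator (b 0) := by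
      have h1 : inner ℝ (b (Fin.last n)) (b k) = 0 := b.orthonormal.2 (Ne.symm hk.2)
      have h2 : inner ℝ (b 0) (b k) = 0 := b.orthonormal.2 (Ne.symm hk.1)
      constructor
      · rw [← pow_left_inj₀ (norm_nonneg _) zero_le_one two_ne_zero, norm_add_sq_real]
        simp [norm_smul, inner_smul_left, inner_smul_right, h1]
      · simp [inner_add_right, inner_smul_right, h2, hy.2]
    have := hz _ hmem
    simp only [cos_zero, sin_zero, one_smul, zero_smul, add_zero]
    linarith
  have hsum := Finset.sum_nonneg hang
  rw [Finset.sum_sub_distrib] at hsum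
  have hap : a * p = a + 2 := by
    rw [hp, show a = ((n : ℝ) - 2) / 2 by linarith]
    have : (n : ℝ) - 2 ≠ 0 := by linarith
    field_simp; ring
  have key (r : ℝ) : cosh r ^ (-a) / cosh r ^ 2 *
      (eLaplacian V (cylinderPoint (b 0) r (b (Fin.last n)))
        - a * (a + 1) * V (cylinderPoint (b 0) r (b (Fin.last n))))
      = -(cylinderFun a V (b 0) r (b (Fin.last n)) ^ p *
        (V (b (Fin.last n) + sinh r • b 0) ^ (-p) * f (V (b (Fin.last n) + sinh r • b 0)))) := by
    have hv := h.pos _ (add_sinh_smul_ne_zero he hy r)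
    have heq := h.equation _ (norm_cylinderPoint he hy.1 hy.2 r)
    rw [apply_cylinderPoint h.homogeneous] at heq ⊢
    rw [cylinderFun, mul_rpow (rpow_nonneg (cosh_pos r).le _) hv.le, ← rpow_mul (cosh_pos r).le,
      neg_mul, hap, neg_add, rpow_add (cosh_pos r), rpow_neg hv.le, rpow_neg (cosh_pos r).le 2,
      rpow_two, ← heq]
    have := rpow_pos_of_pos hv p
    have haa : a * (a + 1) = n * ((n : ℝ) - 2) / 4 := by
      rw [show a = ((n : ℝ) - 2) / 2 by linarith]; ring
    rw [haa]
    field_simp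
    ring
  rw [key] at hsum₁ hsum₂
  linarith

end IsConformalSolution

end Equation

section Reflection

open Real Set

theorem reaction_sub_le {a p A B g₁ g₂ G : ℝ} (hp : 1 ≤ p) (hA : 0 < A) (hAB : A < B)
    (hlt : g₂ ≤ g₁) (hg : g₂ ≤ G) (hG : 0 ≤ G) :
    a ^ 2 * (A - B) + B ^ p * g₂ - A ^ p * g₁ ≤ (B - A) * (p * B ^ (p - 1) * G - a ^ 2) := by
  have h1 : A ^ p * g₂ ≤ A ^ p * g₁ := mul_le_mul_of_nonneg_left hlt (rpow_pos_of_pos hA p).le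
  have hmono : A ^ p ≤ B ^ p := rpow_le_rpow hA.le hAB.le (by linarith)
  have h2 : (B ^ p - A ^ p) * g₂ ≤ (B ^ p - A ^ p) * G :=
    mul_le_mul_of_nonneg_left hg (by linarith)
  have h3 : (B ^ p - A ^ p) * G ≤ p * B ^ (p - 1) * (B - A) * G :=
    mul_le_mul_of_nonneg_right (rpow_sub_rpow_le hp hA (hA.trans hAB)) hG
  linarith

theorem bounds_of_barrier_le {a q k C D c τ : ℝ} (ha : 0 < a) (hC : 0 ≤ C) (hk : k = 6 * C + 1)
    (hc : 1 ≤ c) (hD : 0 < D) (hDq : D ≤ -q)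
    (h : q * (-(k ^ 2 * exp (-(k * τ)) / 2)) ≤ D * (C / c ^ 2 - a ^ 2)) :
    c ≤ C / a ^ 2 + 1 ∧ 1 / k ≤ τ := by
  have hk0 : 1 ≤ k := by linarith
  have hE := exp_pos (-(k * τ))
  have hq : q < 0 := by linarith
  have hc2 : 1 ≤ c ^ 2 := one_le_pow₀ hc
  have hK : 0 < k ^ 2 * exp (-(k * τ)) / 2 := by positivity
  have hpos : 0 < C / c ^ 2 - a ^ 2 :=
    pos_of_mul_pos_right ((mul_pos_of_neg_of_neg hq (neg_lt_zero.2 hK)).trans_le h) hD.le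
  constructor
  · rw [sub_pos, lt_div_iff₀ (by positivity)] at hpos
    have : c ^ 2 < C / a ^ 2 := by
      rw [lt_div_iff₀ (by positivity)]
      linarith
    nlinarith
  · by_contra! hcon
    have hkt : k * τ ≤ 1 := by
      rw [lt_div_iff₀ (by linarith)] at hcon
      linarith
    have hE3 : 1 / 3 ≤ exp (-(k * τ)) := by
      refine le_trans ?_ (exp_le_exp.2 (show -1 ≤ -(k * τ) by linarith))
      rw [exp_neg, ← one_div]
      exact one_div_le_one_div_of_le (exp_pos 1) (by linarith [exp_one_lt_d9])
    have h1 : D * (C / c ^ 2 - a ^ 2) ≤ -q * C := by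
      have : C / c ^ 2 ≤ C := div_le_self hC hc2
      calc _ ≤ D * C := mul_le_mul_of_nonneg_left (by linarith [sq_nonneg a]) hD.le
        _ ≤ _ := mul_le_mul_of_nonneg_right hDq hC
    have h2 : k ^ 2 * exp (-(k * τ)) / 2 ≤ C :=
      le_of_mul_le_mul_left (by linarith) (neg_pos.2 hq)
    have h3 : k ^ 2 * (1 / 3) ≤ k ^ 2 * exp (-(k * τ)) :=
      mul_le_mul_of_nonneg_left hE3 (sq_nonneg k)
    nlinarith

namespace IsConformalSolution

variable {n : ℕ} {f : ℝ → ℝ} {V : EuclideanSpace ℝ (Fin (n + 1)) → ℝ}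
  {e y : EuclideanSpace ℝ (Fin (n + 1))}

theorem lt_of_cylinderFun_le (h : IsConformalSolution n f V) {a p s t : ℝ} (ha : 0 < a)
    (hp : p = ((n : ℝ) + 2) / ((n : ℝ) - 2)) (he : ‖e‖ = 1) (hy : y ∈ equator e)
    (hs : s < 0) (hst : s < t)
    (hle : cylinderFun a V e t y ≤ cylinderFun a V e (2 * s - t) y) :
    V (y + sinh (2 * s - t) • e) ^ (-p) * f (V (y + sinh (2 * s - t) • e))
      < V (y + sinh t • e) ^ (-p) * f (V (y + sinh t • e)) := by
  have hv := h.pos _ (add_sinh_smul_ne_zero he hy t)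
  have hv' := h.pos _ (add_sinh_smul_ne_zero he hy (2 * s - t))
  have hcosh : cosh t < cosh (2 * s - t) := by
    rw [cosh_lt_cosh, abs_of_neg (show 2 * s - t < 0 by linarith), abs_lt]
    constructor <;> linarith
  have hlt : V (y + sinh t • e) < V (y + sinh (2 * s - t) • e) := by
    rw [cylinderFun, cylinderFun] at hle
    have hpow : cosh (2 * s - t) ^ (-a) < cosh t ^ (-a) :=
      rpow_lt_rpow_of_neg (cosh_pos t) hcosh (by linarith)
    by_contra! hcon
    have h1 := mul_lt_mul_of_pos_right hpow hv'
    have h2 := mul_le_mul_of_nonneg_left hcon (rpow_nonneg (cosh_pos t).le (-a))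
    linarith
  rw [hp]
  exact h.strictAntiOn hv hv' hlt

/-- If the comparison across `t = s` fails, then it fails at a point which lies in a fixed compact
set and stays away from `t = s`. -/
theorem exists_neg_of_neg (h : IsConformalSolution n f V) (hn : 3 ≤ n) {a : ℝ}
    (ha : 2 * a = n - 2) (he : ‖e‖ = 1) :
    ∃ δ R : ℝ, 0 < δ ∧ ∀ s < 0, ∀ t ≥ s, ∀ y ∈ equator e,
      cylinderFun a V e t y - cylinderFun a V e (2 * s - t) y < 0 →
      -R ≤ s ∧ ∃ t' ∈ Icc (s + δ) R, ∃ y' ∈ equator e,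
        cylinderFun a V e t' y' - cylinderFun a V e (2 * s - t') y' < 0 := by
  have hn' : (3 : ℝ) ≤ n := by exact_mod_cast hn
  have ha0 : 0 < a := by linarith
  obtain ⟨p, hp⟩ : ∃ p : ℝ, p = ((n : ℝ) + 2) / ((n : ℝ) - 2) := ⟨_, rfl⟩
  have hap : a * (p - 1) = 2 := by
    rw [hp, show a = ((n : ℝ) - 2) / 2 by linarith]
    have : (n : ℝ) - 2 ≠ 0 := by linarith
    field_simp; ring
  have hp1 : 0 < p - 1 := by
    by_contra! hcon
    nlinarith
  obtain ⟨m, M, hm, hM, hmM⟩ := h.exists_bounds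
  obtain ⟨G, hG⟩ : ∃ G, G = max (m ^ (-p) * f m) 0 := ⟨_, rfl⟩
  have hG0 : 0 ≤ G := hG ▸ le_max_right _ _
  obtain ⟨C, hC⟩ : ∃ C, C = G * p * M ^ (p - 1) := ⟨_, rfl⟩
  have hC0 : 0 ≤ C := by rw [hC]; have : 0 < p := by linarith
                         positivity
  obtain ⟨k, hk⟩ : ∃ k, k = 6 * C + 1 := ⟨_, rfl⟩
  have hk0 : 1 ≤ k := by linarith
  refine ⟨1 / k, C / a ^ 2 + 1, by positivity, ?_⟩
  intro s hs t₁ ht₁ y₁ hy₁ hneg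
  obtain ⟨W, hW⟩ : ∃ W : ℝ → EuclideanSpace ℝ (Fin (n + 1)) → ℝ, W = fun t y =>
    cylinderFun a V e t y - cylinderFun a V e (2 * s - t) y := ⟨_, rfl⟩
  obtain ⟨φ, hφ⟩ : ∃ φ : ℝ → ℝ, φ = fun t => 1 - exp (-(k * (t - s))) / 2 := ⟨_, rfl⟩
  have hφle (t : ℝ) : φ t ≤ 1 := by
    rw [hφ]; have := exp_pos (-(k * (t - s))); simp only; linarith
  have hφge {t : ℝ} (ht : s ≤ t) : 1 / 2 ≤ φ t := by
    have : exp (-(k * (t - s))) ≤ 1 := exp_le_one_iff.2 (by nlinarith)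
    rw [hφ]; simp only; linarith
  have hUle {r : ℝ} {z} (hz : z ∈ equator e) : cylinderFun a V e r z ≤ cosh r ^ (-a) * M :=
    mul_le_mul_of_nonneg_left (hmM _ (add_sinh_smul_ne_zero he hz r)).2
      (rpow_nonneg (cosh_pos r).le _)
  have hUpos {r : ℝ} {z} (hz : z ∈ equator e) : 0 < cylinderFun a V e r z :=
    mul_pos (rpow_pos_of_pos (cosh_pos r) _) (h.pos _ (add_sinh_smul_ne_zero he hz r))
  obtain ⟨q₁, hq₁⟩ : ∃ q₁, q₁ = W t₁ y₁ / φ t₁ := ⟨_, rfl⟩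
  have hWneg : W t₁ y₁ < 0 := by rw [hW]; exact hneg
  have hq₁0 : q₁ < 0 := by
    rw [hq₁]; exact div_neg_of_neg_of_pos hWneg (by linarith [hφge ht₁])
  -- The quotient `W / φ` attains its minimum over `t ≥ s`.
  obtain ⟨T, hT₁, hT⟩ : ∃ T, t₁ ≤ T ∧ ∀ t ≥ T, ∀ z ∈ equator e, q₁ ≤ W t z / φ t := by
    have hlim : Tendsto (fun t => cosh (2 * s - t) ^ (-a) * M) atTop (𝓝 0) := by
      have hc : Tendsto (fun t => cosh (2 * s - t)) atTop atTop := by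
        refine tendsto_atTop_mono (fun t => ?_) (tendsto_atTop_add_const_right atTop (-(2 * s))
          tendsto_id)
        have := abs_le_cosh (2 * s - t)
        have := neg_abs_le (2 * s - t)
        simp only [id]; linarith
      simpa using ((tendsto_rpow_neg_atTop ha0).comp hc).mul_const M
    obtain ⟨T, hT⟩ := eventually_atTop.1
      (hlim.eventually (gt_mem_nhds (show 0 < -q₁ / 2 by linarith)))
    refine ⟨max T t₁, le_max_right _ _, fun t ht z hz => ?_⟩
    have h1 := hT t ((le_max_left _ _).trans ht)
    have h2 := hφge (ht₁.le.trans ((le_max_right _ _).trans ht))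
    rw [le_div_iff₀ (by linarith), hW]
    have h3 := hUpos (r := t) hz
    have h4 := hUle (r := 2 * s - t) hz
    simp only
    nlinarith
  have hcont : ContinuousOn (fun x : ℝ × EuclideanSpace ℝ (Fin (n + 1)) => W x.1 x.2 / φ x.1)
      (Icc s T ×ˢ equator e) := by
    refine ContinuousOn.div ?_ ?_ ?_
    · rw [hW]
      exact (h.continuousOn_cylinderFun_sub he a).comp
        (f := fun x : ℝ × EuclideanSpace ℝ (Fin (n + 1)) => (s, x)) (by fun_prop)
        fun x hx => hx.2
    · rw [hφ]; fun_prop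
    · intro x hx
      linarith [hφge hx.1.1]
  obtain ⟨⟨t₀, y₀⟩, ⟨ht₀, hy₀⟩, hmin⟩ := (isCompact_Icc.prod (isCompact_equator e)).exists_isMinOn
    ⟨(t₁, y₁), ⟨ht₁, hT₁⟩, hy₁⟩ hcont
  obtain ⟨q, hq⟩ : ∃ q, q = W t₀ y₀ / φ t₀ := ⟨_, rfl⟩
  have hqq₁ : q ≤ q₁ := by
    rw [hq, hq₁]; exact hmin (show (t₁, y₁) ∈ Icc s T ×ˢ equator e from ⟨⟨ht₁, hT₁⟩, hy₁⟩)
  have hφ₀ := hφge ht₀.1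
  have hWq : W t₀ y₀ = q * φ t₀ := by rw [hq]; field_simp
  have hall {t : ℝ} (ht : s ≤ t) {z} (hz : z ∈ equator e) : q * φ t ≤ W t z := by
    have hφt := hφge ht
    rw [← le_div_iff₀ (by linarith)]
    rcases le_total t T with htT | htT
    · rw [hq]; exact hmin (show (t, z) ∈ Icc s T ×ˢ equator e from ⟨⟨ht, htT⟩, hz⟩)
    · exact hqq₁.trans (hT t htT z hz)
  have hW₀ : W t₀ y₀ < 0 := by rw [hWq]; nlinarith
  have hst₀ : s < t₀ := by
    refine lt_of_le_of_ne ht₀.1 ?_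
    rintro rfl
    rw [hW] at hW₀
    simp only [two_mul, add_sub_cancel_right, sub_self, lt_irrefl] at hW₀
  have hbarrier : HasSecondDerivAt (fun t => q * φ t) (q * (k * exp (-(k * (t₀ - s))) / 2))
      (q * (-(k ^ 2 * exp (-(k * (t₀ - s))) / 2))) t₀ := by
    have hlin (x : ℝ) : HasDerivAt (fun t => exp (-(k * (t - s))))
        (exp (-(k * (x - s))) * -(k * 1)) x :=
      ((((hasDerivAt_id x).sub_const s).const_mul k).neg).exp
    rw [hφ]
    refine HasSecondDerivAt.const_mul q ⟨fun x => k * exp (-(k * (x - s))) / 2,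
      .of_forall fun x => ?_, rfl, ?_⟩
    · exact (((hlin x).div_const 2).const_sub 1).congr_deriv (by ring)
    · exact (((hlin t₀).const_mul k).div_const 2).congr_deriv (by ring)
  have hineq := h.le_of_touching (s := s) hn ha hp he hy₀ hbarrier
    (by rw [← hWq, hW])
    (by filter_upwards [lt_mem_nhds hst₀] with x hx
        have := hall hx.le hy₀; rwa [hW] at this)
    (fun z hz => by have := hall hst₀.le hz; rwa [hW] at this)
  have hlt := h.lt_of_cylinderFun_le ha0 hp he hy₀ hs hst₀
    (by rw [hW] at hW₀; linarith)
  have hg : V (y₀ + sinh (2 * s - t₀) • e) ^ (-p) * f (V (y₀ + sinh (2 * s - t₀) • e)) ≤ G := by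
    rw [hG]
    refine le_max_of_le_left ?_
    rw [hp]
    have hx := add_sinh_smul_ne_zero he hy₀ (2 * s - t₀)
    exact h.strictAntiOn.antitoneOn hm (h.pos _ hx) (hmM _ hx).1
  have hA := hUpos (r := t₀) hy₀
  have hB := hUpos (r := 2 * s - t₀) hy₀
  have hBM := hUle (r := 2 * s - t₀) hy₀
  have hBA : cylinderFun a V e (2 * s - t₀) y₀ - cylinderFun a V e t₀ y₀ = -(q * φ t₀) := by
    rw [← hWq, hW]; ring
  rw [hW] at hW₀
  have hq0 : q < 0 := by linarith
  have hbase := hineq.trans (reaction_sub_le (by linarith) hA (by linarith) hlt.le hg hG0)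
  have hBp : cylinderFun a V e (2 * s - t₀) y₀ ^ (p - 1)
      ≤ M ^ (p - 1) / cosh (2 * s - t₀) ^ 2 := by
    refine (rpow_le_rpow hB.le hBM hp1.le).trans_eq ?_
    rw [mul_rpow (rpow_nonneg (cosh_pos _).le _) hM.le, ← rpow_mul (cosh_pos _).le, neg_mul, hap,
      rpow_neg (cosh_pos _).le, rpow_two]
    ring
  have hCbound : p * cylinderFun a V e (2 * s - t₀) y₀ ^ (p - 1) * G
      ≤ C / cosh (2 * s - t₀) ^ 2 := by
    have := mul_le_mul_of_nonneg_left hBp (mul_nonneg hG0 (show 0 ≤ p by linarith))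
    calc _ = G * p * cylinderFun a V e (2 * s - t₀) y₀ ^ (p - 1) := by ring
      _ ≤ _ := this
      _ = _ := by rw [hC]; ring
  rw [hBA] at hbase
  have hD0 : 0 < -(q * φ t₀) := by linarith
  have hDq : -(q * φ t₀) ≤ -q := by nlinarith [hφle t₀]
  obtain ⟨hcosh, hδ⟩ := bounds_of_barrier_le ha0 hC0 hk (one_le_cosh (2 * s - t₀)) hD0 hDq
    (hbase.trans (mul_le_mul_of_nonneg_left (by linarith) hD0.le))
  have hR := abs_le.1 ((abs_le_cosh _).trans hcosh)
  exact ⟨by linarith [hR.1], t₀, ⟨by linarith, by linarith [hR.1]⟩, y₀, hy₀, hW₀⟩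

theorem reflection_le (h : IsConformalSolution n f V) (hn : 3 ≤ n) {a : ℝ}
    (ha : 2 * a = n - 2) (he : ‖e‖ = 1) {s : ℝ} (hs : s < 0) {t : ℝ} (ht : s ≤ t)
    (hy : y ∈ equator e) : cylinderFun a V e (2 * s - t) y ≤ cylinderFun a V e t y := by
  by_contra! hcon
  have hn' : (3 : ℝ) ≤ n := by exact_mod_cast hn
  obtain ⟨δ, R, hδ, hcpt⟩ := h.exists_neg_of_neg hn ha he
  have hcont := h.continuousOn_cylinderFun_sub he a
  obtain ⟨w, hw⟩ : ∃ w : ℝ × ℝ × EuclideanSpace ℝ (Fin (n + 1)) → ℝ, w = fun q =>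
    cylinderFun a V e q.2.1 q.2.2 - cylinderFun a V e (2 * q.1 - q.2.1) q.2.2 := ⟨_, rfl⟩
  rw [← hw] at hcont
  obtain ⟨bad, hbad⟩ : ∃ bad : Set ℝ, bad = {s | s < 0 ∧ ∃ t ≥ s, ∃ y ∈ equator e,
    w (s, t, y) < 0} := ⟨_, rfl⟩
  have hne : bad.Nonempty := by
    rw [hbad, hw]; exact ⟨s, hs, t, ht, y, hy, by simpa using hcon⟩
  have hcpt' {s : ℝ} (hs : s ∈ bad) : -R ≤ s ∧ ∃ t' ∈ Icc (s + δ) R, ∃ y' ∈ equator e,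
      w (s, t', y') < 0 := by
    rw [hbad] at hs
    obtain ⟨hs, t, ht, y, hy, hneg⟩ := hs
    rw [hw] at hneg ⊢
    exact hcpt s hs t ht y hy hneg
  have hbdd : BddBelow bad := ⟨-R, fun s hs => (hcpt' hs).1⟩
  obtain ⟨s₀, hs₀⟩ : ∃ s₀, s₀ = sInf bad := ⟨_, rfl⟩
  have hs₀neg : s₀ < 0 := by
    obtain ⟨s, hs⟩ := hne
    have h1 := csInf_le hbdd hs
    rw [hbad] at hs
    linarith [hs.1]
  -- At the critical value the comparison still holds.
  have hgood {t : ℝ} (ht : s₀ ≤ t) {z} (hz : z ∈ equator e) : 0 ≤ w (s₀, t, z) := by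
    by_contra! hlt
    have hc : Tendsto (fun s => w (s, t, z)) (𝓝[<] s₀) (𝓝 (w (s₀, t, z))) := by
      have : Continuous fun s => w (s, t, z) :=
        hcont.comp_continuous (by fun_prop) fun s => hz
      exact this.continuousWithinAt
    obtain ⟨s, hsw, hss⟩ := ((hc.eventually (gt_mem_nhds hlt)).and self_mem_nhdsWithin).exists
    have hmem : s ∈ bad := by
      rw [hbad]
      exact ⟨lt_trans hss hs₀neg, t, (le_of_lt hss).trans ht, z, hz, hsw⟩
    have := csInf_le hbdd hmem
    rw [← hs₀] at this
    exact absurd hss (not_lt.2 this)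
  -- Negative values persist in the limit, which produces a touching point.
  obtain ⟨t₀, y₀, ht₀, hy₀, hw₀⟩ : ∃ t₀ y₀, s₀ + δ ≤ t₀ ∧ y₀ ∈ equator e ∧ w (s₀, t₀, y₀) ≤ 0 := by
    have hK : IsCompact (Icc (-R) 0 ×ˢ Icc (-R) R ×ˢ equator e) :=
      isCompact_Icc.prod (isCompact_Icc.prod (isCompact_equator e))
    have hKc : IsCompact ((Icc (-R) 0 ×ˢ Icc (-R) R ×ˢ equator e) ∩
        (w ⁻¹' Iic 0 ∩ {q | q.1 + δ ≤ q.2.1})) := by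
      rw [← inter_assoc]
      refine IsCompact.inter_right ?_ (isClosed_le (by fun_prop) (by fun_prop))
      exact hK.of_isClosed_subset ((hcont.mono fun q hq => hq.2.2).preimage_isClosed_of_isClosed
        hK.isClosed isClosed_Iic) inter_subset_left
    have hclosed := (hKc.image continuous_fst).isClosed
    have hsub : bad ⊆ Prod.fst '' ((Icc (-R) 0 ×ˢ Icc (-R) R ×ˢ equator e) ∩
        (w ⁻¹' Iic 0 ∩ {q | q.1 + δ ≤ q.2.1})) := by
      intro s hs
      obtain ⟨h1, t', ht', y', hy', hneg⟩ := hcpt' hs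
      rw [hbad] at hs
      exact ⟨(s, t', y'), ⟨⟨⟨h1, hs.1.le⟩, ⟨by linarith [ht'.1], ht'.2⟩, hy'⟩, hneg.le, ht'.1⟩, rfl⟩
    obtain ⟨⟨s', t', y'⟩, ⟨⟨-, -, hy'⟩, hneg, hst⟩, hs'⟩ :=
      closure_minimal hsub hclosed (csInf_mem_closure hne hbdd)
    rw [← hs₀] at hs'
    obtain rfl : s' = s₀ := hs'
    exact ⟨t', y', hst, hy', hneg⟩
  have hst₀ : s₀ < t₀ := by linarith
  have hzero : cylinderFun a V e t₀ y₀ - cylinderFun a V e (2 * s₀ - t₀) y₀ = 0 := by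
    have := le_antisymm hw₀ (hgood hst₀.le hy₀)
    rwa [hw] at this
  have hineq := h.le_of_touching (s := s₀) hn ha rfl he hy₀ (HasSecondDerivAt.const 0 t₀)
    hzero.symm
    (by filter_upwards [lt_mem_nhds hst₀] with x hx
        have := hgood hx.le hy₀; rwa [hw] at this)
    (fun z hz => by have := hgood hst₀.le hz; rwa [hw] at this)
  have hlt := h.lt_of_cylinderFun_le (show 0 < a by linarith) rfl he hy₀ hs₀neg hst₀
    (by linarith)
  have hA : 0 < cylinderFun a V e t₀ y₀ :=
    mul_pos (rpow_pos_of_pos (cosh_pos _) _) (h.pos _ (add_sinh_smul_ne_zero he hy₀ t₀))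
  rw [← sub_eq_zero.1 hzero, sub_self, mul_zero, zero_add] at hineq
  have := mul_lt_mul_of_pos_left hlt (rpow_pos_of_pos hA (((n : ℝ) + 2) / ((n : ℝ) - 2)))
  linarith

theorem sub_smul_le_add_smul (h : IsConformalSolution n f V) (hn : 3 ≤ n) (he : ‖e‖ = 1)
    (hy : y ∈ equator e) {r : ℝ} (hr : 0 ≤ r) : V (y - r • e) ≤ V (y + r • e) := by
  obtain ⟨t, rfl⟩ := sinh_surjective r
  have ht : 0 ≤ t := sinh_nonneg_iff.1 hr
  obtain ⟨a, ha⟩ : ∃ a : ℝ, 2 * a = n - 2 := ⟨((n : ℝ) - 2) / 2, by ring⟩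
  have hc : Continuous fun s : ℝ =>
      cylinderFun a V e t y - cylinderFun a V e (2 * s - t) y :=
    (h.continuousOn_cylinderFun_sub he a).comp_continuous
      (f := fun s : ℝ => (s, t, y)) (by fun_prop) fun s => hy
  have h0 := ge_of_tendsto (hc.continuousWithinAt (s := Iio 0) (x := 0)).tendsto (by
    filter_upwards [self_mem_nhdsWithin] with s hs
    exact sub_nonneg.2 (h.reflection_le hn ha he hs ((le_of_lt hs).trans ht) hy))
  simp only [cylinderFun, mul_zero, zero_sub, cosh_neg, sinh_neg, neg_smul, ← mul_sub] at h0
  have := nonneg_of_mul_nonneg_right h0 (rpow_pos_of_pos (cosh_pos t) _)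
  rw [sub_eq_add_neg]
  linarith

theorem add_smul_eq_sub_smul (h : IsConformalSolution n f V) (hn : 3 ≤ n) (he : ‖e‖ = 1)
    (hy : y ∈ equator e) {r : ℝ} (hr : 0 ≤ r) : V (y + r • e) = V (y - r • e) := by
  refine le_antisymm ?_ (h.sub_smul_le_add_smul hn he hy hr)
  have := h.sub_smul_le_add_smul (e := -e) hn (by rwa [norm_neg])
    ⟨hy.1, by rw [inner_neg_left, hy.2, neg_zero]⟩ hr
  simpa [sub_eq_add_neg] using this

theorem apply_eq_of_ne_neg (h : IsConformalSolution n f V) (hn : 3 ≤ n)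
    {x z : EuclideanSpace ℝ (Fin (n + 1))} (hx : ‖x‖ = 1) (hz : ‖z‖ = 1) (hxz : x + z ≠ 0) :
    V x = V z := by
  rcases eq_or_ne x z with rfl | hne
  · rfl
  have hd : 0 < ‖x - z‖ := norm_pos_iff.2 (sub_ne_zero.2 hne)
  have hm : 0 < ‖x + z‖ := norm_pos_iff.2 hxz
  have hy : ‖x + z‖⁻¹ • (x + z) ∈ equator (‖x - z‖⁻¹ • (x - z)) := by
    refine ⟨by rw [norm_smul, norm_inv, norm_norm, inv_mul_cancel₀ hm.ne'], ?_⟩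
    rw [inner_smul_left, inner_smul_right, real_inner_comm,
      (real_inner_add_sub_eq_zero_iff x z).2 (hx.trans hz.symm)]
    simp
  have key := h.add_smul_eq_sub_smul hn (e := ‖x - z‖⁻¹ • (x - z))
    (by simp [norm_smul, hd.ne']) hy (r := ‖x - z‖ / ‖x + z‖) (by positivity)
  have h1 : (‖x - z‖ / ‖x + z‖) • ‖x - z‖⁻¹ • (x - z) = ‖x + z‖⁻¹ • (x - z) := by
    rw [smul_smul]; congr 1; field_simp
  have h2 : ‖x + z‖⁻¹ • (x + z) + ‖x + z‖⁻¹ • (x - z) = (2 * ‖x + z‖⁻¹) • x := by module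
  have h3 : ‖x + z‖⁻¹ • (x + z) - ‖x + z‖⁻¹ • (x - z) = (2 * ‖x + z‖⁻¹) • z := by module
  rwa [h1, h2, h3, h.homogeneous _ (by positivity), h.homogeneous _ (by positivity)] at key

theorem apply_eq (h : IsConformalSolution n f V) (hn : 3 ≤ n)
    {x z : EuclideanSpace ℝ (Fin (n + 1))} (hx : ‖x‖ = 1) (hz : ‖z‖ = 1) : V x = V z := by
  by_cases hxz : x + z = 0
  · obtain ⟨w, hw⟩ : ∃ w : EuclideanSpace ℝ (Fin (n + 1)), w ∈ equator x := by
      have hv : Orthonormal ℝ (({0} : Set (Fin (n + 1))).domRestrict fun _ => x) :=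
        ⟨fun _ => hx, fun i j hij => absurd (Subsingleton.elim i j) hij⟩
      obtain ⟨b, hb⟩ := hv.exists_orthonormalBasis_extension_of_card_eq (by simp)
      refine ⟨b (Fin.last n), b.norm_eq_one _, ?_⟩
      rw [← hb 0 rfl]
      refine b.orthonormal.2 fun h0 => ?_
      have := congrArg Fin.val h0
      simp at this
      omega
    have hwx {u : EuclideanSpace ℝ (Fin (n + 1))} (hu : ‖u‖ = 1) (huw : inner ℝ u w = 0) :
        u + w ≠ 0 := by
      intro h0
      rw [eq_neg_of_add_eq_zero_left h0, inner_neg_left, real_inner_self_eq_norm_sq, hw.1] at huw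
      norm_num at huw
    have hzw : inner ℝ z w = 0 := by
      rw [eq_neg_of_add_eq_zero_right hxz, inner_neg_left, hw.2, neg_zero]
    rw [h.apply_eq_of_ne_neg hn hx hw.1 (hwx hx hw.2),
      h.apply_eq_of_ne_neg hn hz hw.1 (hwx hz hzw)]
  · exact h.apply_eq_of_ne_neg hn hx hz hxz

end IsConformalSolution

end Reflection

end MovingPlanes

theorem stmt13 (n : ℕ) (hn : 3 ≤ n) (f : ℝ → ℝ)
    (hf_cont : ContinuousOn f (Set.Ici (0 : ℝ)))
    (hf_dec : StrictAntiOn (fun s : ℝ => s ^ (-(((n : ℝ) + 2) / ((n : ℝ) - 2))) * f s)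
      (Set.Ioi 0))
    (v : EuclideanSpace ℝ (Fin (n + 1)) → ℝ)
    (hv : ContDiffOn ℝ 2 (fun x => v (‖x‖⁻¹ • x)) {x | x ≠ 0})
    (hvpos : ∀ θ ∈ Metric.sphere (0 : EuclideanSpace ℝ (Fin (n + 1))) 1, 0 < v θ)
    (heq : ∀ θ ∈ Metric.sphere (0 : EuclideanSpace ℝ (Fin (n + 1))) 1,
      -sphLaplacian v θ + ((n : ℝ) * ((n : ℝ) - 2) / 4) * v θ = f (v θ)) :
    ∃ c : ℝ, 0 < c ∧
      (∀ θ ∈ Metric.sphere (0 : EuclideanSpace ℝ (Fin (n + 1))) 1, v θ = c) ∧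
      f c = ((n : ℝ) * ((n : ℝ) - 2) / 4) * c := by
  have hn' : (3 : ℝ) ≤ n := by exact_mod_cast hn
  have hne {θ : EuclideanSpace ℝ (Fin (n + 1))} (hθ : ‖θ‖ = 1) : θ ≠ 0 := by
    rw [← norm_ne_zero_iff, hθ]; exact one_ne_zero
  have hunit {x : EuclideanSpace ℝ (Fin (n + 1))} (hx : x ≠ 0) : ‖‖x‖⁻¹ • x‖ = 1 := by
    rw [norm_smul, norm_inv, norm_norm, inv_mul_cancel₀ (norm_ne_zero_iff.2 hx)]
  have hv1 {θ : EuclideanSpace ℝ (Fin (n + 1))} (hθ : ‖θ‖ = 1) : v (‖θ‖⁻¹ • θ) = v θ := by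
    rw [hθ, inv_one, one_smul]
  have hsol : IsConformalSolution n f (fun x => v (‖x‖⁻¹ • x)) :=
    { strictAntiOn := hf_dec
      homogeneous := fun c hc x => by
        rw [norm_smul, Real.norm_eq_abs, abs_of_pos hc, smul_smul, mul_inv, mul_right_comm,
          inv_mul_cancel₀ hc.ne', one_mul]
      contDiffAt := fun x hx => hv.contDiffAt (isOpen_ne.mem_nhds hx)
      pos := fun x hx => hvpos _ (by simpa using hunit hx)
      equation := fun θ hθ => by
        rw [hv1 hθ]
        exact heq θ (by simpa using hθ) }
  have hconst {x z : EuclideanSpace ℝ (Fin (n + 1))} (hx : ‖x‖ = 1) (hz : ‖z‖ = 1) :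
      v x = v z := by
    rw [← hv1 hx, ← hv1 hz]
    exact hsol.apply_eq hn hx hz
  obtain ⟨θ, hθ⟩ : ∃ θ : EuclideanSpace ℝ (Fin (n + 1)), ‖θ‖ = 1 :=
    ⟨EuclideanSpace.single 0 1, by simp⟩
  have hθs : θ ∈ Metric.sphere (0 : EuclideanSpace ℝ (Fin (n + 1))) 1 := by simpa using hθ
  refine ⟨v θ, hvpos θ hθs, fun z hz => hconst (by simpa using hz) hθ, ?_⟩
  have hloc : (fun x => v (‖x‖⁻¹ • x)) =ᶠ[nhds θ] fun _ => v θ := by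
    filter_upwards [isOpen_ne.mem_nhds (hne hθ)] with x hx using hconst (hunit hx) hθ
  have hlap : sphLaplacian v θ = 0 := by
    rw [sphLaplacian, eLaplacian, (hloc.iteratedFDeriv ℝ 2).eq_of_nhds]
    simp [iteratedFDeriv_const_of_ne]
  rw [← heq θ hθs, hlap, neg_zero, zero_add]
end

section
/- Let 0 < β < 1. If v ∈ C²(S²) satisfies −Δ_{S²} v + β = e^{2v} on S², then v is a constant function. -/
open scoped BigOperators

section PartialDerivatives

open MeasureTheory Filter Topology Convolution

variable {m : ℕ}

/-- The partial derivative of `f` in the `i`-th coordinate direction. -/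
noncomputable def pderiv (i : Fin m) (f : EuclideanSpace ℝ (Fin m) → ℝ)
    (x : EuclideanSpace ℝ (Fin m)) : ℝ :=
  fderiv ℝ f x (EuclideanSpace.single i 1)

variable {f g : EuclideanSpace ℝ (Fin m) → ℝ} {x : EuclideanSpace ℝ (Fin m)} {i j : Fin m}

lemma Filter.EventuallyEq.pderiv_eq (h : f =ᶠ[𝓝 x] g) : pderiv i f x = pderiv i g x := by
  simp only [pderiv, h.fderiv_eq]

lemma pderiv_add (hf : DifferentiableAt ℝ f x) (hg : DifferentiableAt ℝ g x) :
    pderiv i (fun y => f y + g y) x = pderiv i f x + pderiv i g x := by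
  simp [pderiv, fderiv_fun_add hf hg]

lemma pderiv_sub (hf : DifferentiableAt ℝ f x) (hg : DifferentiableAt ℝ g x) :
    pderiv i (fun y => f y - g y) x = pderiv i f x - pderiv i g x := by
  simp [pderiv, fderiv_fun_sub hf hg]

lemma pderiv_mul (hf : DifferentiableAt ℝ f x) (hg : DifferentiableAt ℝ g x) :
    pderiv i (fun y => f y * g y) x = f x * pderiv i g x + g x * pderiv i f x := by
  simp [pderiv, fderiv_fun_mul hf hg]

lemma pderiv_sum {ι : Type*} {s : Finset ι} {F : ι → EuclideanSpace ℝ (Fin m) → ℝ}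
    (hF : ∀ k ∈ s, DifferentiableAt ℝ (F k) x) :
    pderiv i (fun y => ∑ k ∈ s, F k y) x = ∑ k ∈ s, pderiv i (F k) x := by
  simp [pderiv, fderiv_fun_sum hF]

lemma pderiv_comp {h : ℝ → ℝ} (hh : DifferentiableAt ℝ h (f x)) (hf : DifferentiableAt ℝ f x) :
    pderiv i (fun y => h (f y)) x = deriv h (f x) * pderiv i f x := by
  have := (hh.hasDerivAt.comp_hasFDerivAt x hf.hasFDerivAt).fderiv
  simp only [pderiv]
  change fderiv ℝ (h ∘ f) x _ = _
  rw [this]; simp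

lemma pderiv_const (c : ℝ) : pderiv i (fun _ => c) x = 0 := by simp [pderiv]

lemma pderiv_coord : pderiv j (fun y => y i) x = if i = j then 1 else 0 := by
  have : (fun y : EuclideanSpace ℝ (Fin m) => y i) = EuclideanSpace.proj (𝕜 := ℝ) i := rfl
  rw [pderiv, this, ContinuousLinearMap.fderiv]
  simp

lemma pderiv_norm_sq : pderiv i (fun y => ‖y‖ ^ 2) x = 2 * x i := by
  simp [pderiv, fderiv_norm_sq_apply, EuclideanSpace.inner_single_right]

lemma fderiv_apply_eq_sum_pderiv (v : EuclideanSpace ℝ (Fin m)) :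
    fderiv ℝ f x v = ∑ i, v i * pderiv i f x := by
  conv_lhs => rw [← (EuclideanSpace.basisFun (Fin m) ℝ).sum_repr v]
  simp [pderiv]

lemma ContDiff.pderiv {n : ℕ∞} (hf : ContDiff ℝ (n + 1) f) : ContDiff ℝ n (pderiv i f) :=
  (hf.fderiv_right le_rfl).clm_apply contDiff_const

lemma ContDiffOn.pderiv {U : Set (EuclideanSpace ℝ (Fin m))} {n : ℕ∞} (hU : IsOpen U)
    (hf : ContDiffOn ℝ (n + 1) f U) : ContDiffOn ℝ n (pderiv i f) U :=
  (hf.fderiv_of_isOpen hU le_rfl).clm_apply contDiffOn_const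

lemma HasCompactSupport.pderiv (hf : HasCompactSupport f) : HasCompactSupport (pderiv i f) :=
  hf.fderiv_apply (𝕜 := ℝ) _

lemma pderiv_comm (hf : ContDiffAt ℝ 2 f x) :
    pderiv i (pderiv j f) x = pderiv j (pderiv i f) x := by
  have hd : DifferentiableAt ℝ (fderiv ℝ f) x :=
    (hf.fderiv_right (m := 1) (by norm_num)).differentiableAt one_ne_zero
  have h (k l : Fin m) : _root_.pderiv k (_root_.pderiv l f) x
      = fderiv ℝ (fderiv ℝ f) x (EuclideanSpace.single k 1) (EuclideanSpace.single l 1) := by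
    change fderiv ℝ (fun y => fderiv ℝ f y _) x _ = _
    rw [fderiv_clm_apply hd (by fun_prop)]
    simp
  rw [h, h]
  exact (hf.isSymmSndFDerivAt (by simp)).eq _ _

lemma eLaplacian_eq_sum_pderiv (hf : ContDiffAt ℝ 2 f x) :
    eLaplacian f x = ∑ i, pderiv i (pderiv i f) x := by
  have hd : DifferentiableAt ℝ (fderiv ℝ f) x :=
    (hf.fderiv_right (m := 1) (by norm_num)).differentiableAt one_ne_zero
  refine Finset.sum_congr rfl fun i _ => ?_
  change _ = fderiv ℝ (fun y => fderiv ℝ f y _) x _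
  rw [iteratedFDeriv_two_apply, fderiv_clm_apply hd (by fun_prop)]
  simp

lemma pderiv_comp_smul (c : ℝ) : pderiv i (fun y => f (c • y)) x = c * pderiv i f (c • x) := by
  simp [pderiv, fderiv_comp_smul]

/-- The integral of a partial derivative of a compactly supported function vanishes. -/
lemma integral_pderiv_eq_zero (hf : ContDiff ℝ 1 f) (hc : HasCompactSupport f) :
    ∫ x, pderiv i f x = 0 := by
  have hcont : Continuous (pderiv i f) :=
    (ContDiff.pderiv (n := 0) (by simpa using hf)).continuous
  have h := integral_mul_fderiv_eq_neg_fderiv_mul_of_integrable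
    (μ := (volume : Measure (EuclideanSpace ℝ (Fin m)))) (f := fun _ => (1 : ℝ)) (g := f)
    (v := EuclideanSpace.single i 1) (by simp)
    (by simp only [one_mul]; exact hcont.integrable_of_hasCompactSupport hc.pderiv)
    (by simpa using hf.continuous.integrable_of_hasCompactSupport hc)
    (by simp) (fun x _ => hf.differentiable one_ne_zero x)
  simpa [pderiv] using h

lemma pderiv_convolution_right (hf : Continuous f) (hg : ContDiff ℝ 1 g)
    (hgc : HasCompactSupport g) :
    pderiv i (f ⋆ g) = f ⋆ pderiv i g := by
  ext x
  rw [pderiv, (hgc.hasFDerivAt_convolution_right _ hf.locallyIntegrable hg x).fderiv]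
  exact convolution_precompR_apply _ hf.locallyIntegrable (hgc.fderiv ℝ)
    (hg.continuous_fderiv one_ne_zero) _ _

lemma pderiv_convolution_left (hf : ContDiff ℝ 1 f) (hfc : HasCompactSupport f)
    (hg : Continuous g) :
    pderiv i (f ⋆ g) = pderiv i f ⋆ g := by
  have h (a b : EuclideanSpace ℝ (Fin m) → ℝ) : a ⋆ b = b ⋆ a := by
    rw [← convolution_flip]; congr 1; ext; simp
  rw [h f, pderiv_convolution_right hg hf hfc, h]

/-- Mixed partial derivatives commute weakly: only one derivative of each factor is needed. -/
lemma integral_pderiv_mul_pderiv_comm (hf : ContDiff ℝ 1 f) (hfc : HasCompactSupport f)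
    (hg : ContDiff ℝ 1 g) (hgc : HasCompactSupport g) :
    ∫ x, pderiv j f x * pderiv i g x = ∫ x, pderiv i f x * pderiv j g x := by
  set f' : EuclideanSpace ℝ (Fin m) → ℝ := fun x => f (-x)
  have hf' : ContDiff ℝ 1 f' := hf.comp contDiff_neg
  have hfc' : HasCompactSupport f' := hfc.comp_homeomorph (Homeomorph.neg _)
  have hcont {h : EuclideanSpace ℝ (Fin m) → ℝ} (hh : ContDiff ℝ 1 h) (k : Fin m) :
      Continuous (pderiv k h) :=
    (ContDiff.pderiv (n := 0) (by simpa using hh)).continuous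
  have key : pderiv j f' ⋆ pderiv i g = pderiv i f' ⋆ pderiv j g := by
    rw [← pderiv_convolution_right (hcont hf' j) hg hgc,
      ← pderiv_convolution_left hf' hfc' hg.continuous,
      pderiv_convolution_right hf'.continuous hg hgc,
      pderiv_convolution_left hf' hfc' (hcont hg j)]
  have hneg (k : Fin m) (x) : pderiv k f' x = - pderiv k f (-x) := by
    have := pderiv_comp_smul (f := f) (x := x) (i := k) (-1)
    simpa [f'] using this
  have h0 (k l : Fin m) : (pderiv k f' ⋆ pderiv l g) 0 = - ∫ x, pderiv k f x * pderiv l g x := by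
    rw [← integral_neg_eq_self, ← integral_neg]
    simp [convolution_def, hneg]
  have := congrFun key 0
  rwa [h0, h0, neg_inj] at this

lemma ContDiff.mul_of_tsupport_subset {n : WithTop ℕ∞} {U : Set (EuclideanSpace ℝ (Fin m))}
    (hU : IsOpen U) (hf : ContDiff ℝ n f) (hfU : tsupport f ⊆ U) (hg : ContDiffOn ℝ n g U) :
    ContDiff ℝ n (fun x => f x * g x) := by
  refine contDiff_iff_contDiffAt.2 fun x => ?_
  by_cases hx : x ∈ tsupport f
  · exact hf.contDiffAt.mul (hg.contDiffAt (hU.mem_nhds (hfU hx)))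
  · refine (contDiffAt_const (c := (0 : ℝ))).congr_of_eventuallyEq ?_
    filter_upwards [notMem_tsupport_iff_eventuallyEq.1 hx] with y hy
    simp [hy]

end PartialDerivatives

section PointwiseAlgebra

/-- The algebraic content of the divergence identity: `a` is the gradient and `A` the Hessian of a
function whose exponential is homogeneous of degree one, `φ' • X` is the gradient of a radial cutoff
`φ`, and `R` is the inverse square of the norm of `X`. -/
lemma divergence_identity (φ φ' e k R t : ℝ) (X a : Fin 3 → ℝ) (A : Fin 3 → Fin 3 → ℝ)
    (hR : (∑ i, X i ^ 2) * R = 1) (hXa : ∑ i, X i * a i = 1)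
    (hXA : ∀ j, a j + ∑ i, X i * A i j = 0) (hA : ∀ i j, A i j = A j i) (ht : ∑ i, A i i = t) :
    (∑ i, ∑ j, ((φ * (e * (A i j + a i * a j)) + e * a i * (φ' * X j)) * A i j
        - (φ * (e * (A i i + a i * a i)) + e * a i * (φ' * X i)) * A j j))
      + ∑ i, (φ * (2⁻¹ * e * (a i * ((∑ j, a j ^ 2) + t) * (a i + X i * R)
          + (2 * (∑ j, a j * A j i) - 2 * k * R ^ 2 * X i - 2 * (t - k * R) * a i)
              * (a i + X i * R)
          + ((∑ j, a j ^ 2) + t) * (A i i + R - 2 * X i ^ 2 * R ^ 2)))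
        + 2⁻¹ * e * ((∑ j, a j ^ 2) + t) * (a i + X i * R) * (φ' * X i))
    = φ * e * ((∑ i, ∑ j, (A i j + a i * a j) ^ 2 - (∑ i, (A i i + a i * a i)) ^ 2 / 2)
        + k * R * ∑ i, (a i - X i * R) ^ 2) := by
  have hC : ∑ j, a j * ∑ i, X i * A i j = -∑ j, a j ^ 2 := by
    rw [← Finset.sum_neg_distrib]
    refine Finset.sum_congr rfl fun j _ => ?_
    linear_combination a j * hXA j
  have h10 := hA 1 0
  have h20 := hA 2 0
  have h21 := hA 2 1
  simp only [Fin.sum_univ_three] at *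
  rw [h10, h20, h21] at *
  set D := a 0 * a 0 * A 0 0 + a 1 * a 1 * A 1 1 + a 2 * a 2 * A 2 2
    + 2 * (a 0 * a 1 * A 0 1 + a 0 * a 2 * A 0 2 + a 1 * a 2 * A 1 2) with hD
  set n := a 0 ^ 2 + a 1 ^ 2 + a 2 ^ 2 with hn
  set S := A 0 0 ^ 2 + A 1 1 ^ 2 + A 2 2 ^ 2 + 2 * (A 0 1 ^ 2 + A 0 2 ^ 2 + A 1 2 ^ 2) with hS
  set C := a 0 * (X 0 * A 0 0 + X 1 * A 0 1 + X 2 * A 0 2)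
    + a 1 * (X 0 * A 0 1 + X 1 * A 1 1 + X 2 * A 1 2)
    + a 2 * (X 0 * A 0 2 + X 1 * A 1 2 + X 2 * A 2 2) with hCd
  set Q := X 0 * a 0 + X 1 * a 1 + X 2 * a 2 with hQ
  set Y := X 0 ^ 2 + X 1 ^ 2 + X 2 ^ 2 with hY
  have ht' : A 2 2 = t - A 0 0 - A 1 1 := by linarith
  trans φ * e * (S + D - t * t - n * t + 2⁻¹ * ((n + t) * (n + Q * R)
        + (2 * D - 2 * k * R ^ 2 * Q - 2 * (t - k * R) * n
          + R * (2 * C - 2 * k * R ^ 2 * Y - 2 * (t - k * R) * Q))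
        + (n + t) * (t + 3 * R - 2 * Y * R ^ 2)))
      + e * φ' * (C - Q * t + 2⁻¹ * (n + t) * (Q + Y * R))
  · rw [hD, hn, hS, hCd, hQ, hY, ht']; ring
  trans φ * e * (S + 2 * D + n ^ 2 - (t + n) ^ 2 / 2 + k * R * (n - 2 * R * Q + Y * R * R))
  · rw [hC, hXa]
    linear_combination (φ * e * (-2 * k * R ^ 2 - (n + t) * R) + 2⁻¹ * e * φ' * (n + t)) * hR
  · rw [hD, hn, hS, hQ, hY, ht']; ring

lemma half_sq_trace_le (R : ℝ) (X : Fin 3 → ℝ) (T : Fin 3 → Fin 3 → ℝ)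
    (hR : (∑ i, X i ^ 2) * R = 1) (hXT : ∑ i, ∑ j, X i * T i j * X j = 0) :
    0 ≤ ∑ i, ∑ j, T i j ^ 2 - (∑ i, T i i) ^ 2 / 2 := by
  set P := ∑ i, T i i with hP
  have h : ∑ i, ∑ j, (T i j - 2⁻¹ * P * ((if i = j then 1 else 0) - X i * X j * R)) ^ 2
      = ∑ i, ∑ j, T i j ^ 2 - P * (∑ i, T i i - R * ∑ i, ∑ j, X i * T i j * X j)
        + 4⁻¹ * P ^ 2 * (3 - 2 * ((∑ i, X i ^ 2) * R) + ((∑ i, X i ^ 2) * R) ^ 2) := by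
    simp [Fin.sum_univ_three]; ring
  rw [hR, hXT, ← hP] at h
  have h0 : 0 ≤ ∑ i, ∑ j, (T i j - 2⁻¹ * P * ((if i = j then 1 else 0) - X i * X j * R)) ^ 2 := by
    positivity
  linarith

end PointwiseAlgebra

section RadialCutoff

open Metric

variable {m : ℕ}

/-- A radial cutoff function supported in an annulus. -/
noncomputable def radialBump (b : ContDiffBump (2 : ℝ)) (x : EuclideanSpace ℝ (Fin m)) : ℝ :=
  b (‖x‖ ^ 2)

lemma contDiff_radialBump (b : ContDiffBump (2 : ℝ)) {n : ℕ∞} :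
    ContDiff ℝ n (radialBump b : EuclideanSpace ℝ (Fin m) → ℝ) :=
  b.contDiff.comp (contDiff_norm_sq ℝ)

lemma tsupport_radialBump_subset (b : ContDiffBump (2 : ℝ)) :
    tsupport (radialBump b : EuclideanSpace ℝ (Fin m) → ℝ)
      ⊆ {x | ‖x‖ ^ 2 ∈ closedBall (2 : ℝ) b.rOut} := by
  refine closure_minimal (fun x hx => ?_) (isClosed_closedBall.preimage (by fun_prop))
  have : ‖x‖ ^ 2 ∈ Function.support b := hx
  rw [b.support_eq] at this
  exact ball_subset_closedBall this

lemma hasCompactSupport_radialBump (b : ContDiffBump (2 : ℝ)) :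
    HasCompactSupport (radialBump b : EuclideanSpace ℝ (Fin m) → ℝ) := by
  refine HasCompactSupport.of_support_subset_isCompact
    (isCompact_closedBall (0 : EuclideanSpace ℝ (Fin m)) (3 + b.rOut)) fun x hx => ?_
  have h := tsupport_radialBump_subset b (subset_tsupport _ hx)
  simp only [Set.mem_ofPred_eq, mem_closedBall, Real.dist_eq, abs_le] at h
  rw [mem_closedBall_zero_iff]
  nlinarith [norm_nonneg x, b.rOut_pos, h.2]

lemma tsupport_radialBump_subset_ne_zero (b : ContDiffBump (2 : ℝ)) (hb : b.rOut < 2) :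
    tsupport (radialBump b : EuclideanSpace ℝ (Fin m) → ℝ) ⊆ {x | x ≠ 0} := by
  rintro x hx rfl
  have h := tsupport_radialBump_subset b hx
  simp [Real.dist_eq] at h
  linarith

lemma pderiv_radialBump (b : ContDiffBump (2 : ℝ)) (x : EuclideanSpace ℝ (Fin m)) (i : Fin m) :
    pderiv i (radialBump b) x = 2 * deriv b (‖x‖ ^ 2) * x i := by
  change pderiv i (fun y => b (‖y‖ ^ 2)) x = _
  rw [pderiv_comp (b.contDiff.differentiable one_ne_zero _)
    ((contDiff_norm_sq ℝ).differentiable one_ne_zero _), pderiv_norm_sq]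
  ring

end RadialCutoff

section Rigidity

open MeasureTheory Filter Topology

variable {k : ℝ} {u : EuclideanSpace ℝ (Fin 3) → ℝ}

lemma isOpen_setOf_ne_zero : IsOpen {x : EuclideanSpace ℝ (Fin 3) | x ≠ 0} := isOpen_ne

/-- The vector field whose divergence completes the Bochner-type identity. -/
noncomputable def auxField (k : ℝ) (u : EuclideanSpace ℝ (Fin 3) → ℝ) (i : Fin 3)
    (x : EuclideanSpace ℝ (Fin 3)) : ℝ :=
  2⁻¹ * Real.exp (u x) * ((∑ j, pderiv j u x ^ 2) + (k * (‖x‖ ^ 2)⁻¹ + Real.exp (-2 * u x)))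
    * (pderiv i u x + x i * (‖x‖ ^ 2)⁻¹)

lemma contDiffOn_pderiv (hu : ContDiffOn ℝ 2 u {x | x ≠ 0}) (i : Fin 3) :
    ContDiffOn ℝ 1 (pderiv i u) {x | x ≠ 0} :=
  ContDiffOn.pderiv (n := 1) isOpen_setOf_ne_zero hu

lemma contDiffOn_inv_norm_sq {n : ℕ∞} :
    ContDiffOn ℝ n (fun x : EuclideanSpace ℝ (Fin 3) => (‖x‖ ^ 2)⁻¹) {x | x ≠ 0} :=
  (contDiff_norm_sq ℝ).contDiffOn.inv fun x hx => by simpa using hx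

lemma contDiffOn_coord {n : ℕ∞} {U : Set (EuclideanSpace ℝ (Fin 3))} (i : Fin 3) :
    ContDiffOn ℝ n (fun x : EuclideanSpace ℝ (Fin 3) => x i) U :=
  (EuclideanSpace.proj (𝕜 := ℝ) i).contDiff.contDiffOn

lemma contDiffOn_auxField (hu : ContDiffOn ℝ 2 u {x | x ≠ 0}) (i : Fin 3) :
    ContDiffOn ℝ 1 (auxField k u i) {x | x ≠ 0} := by
  have hu1 : ContDiffOn ℝ 1 u {x | x ≠ 0} := hu.of_le (by norm_num)
  have hp := contDiffOn_pderiv hu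
  have hr := contDiffOn_inv_norm_sq (n := 1)
  have hx := contDiffOn_coord (n := 1) (U := {x | x ≠ 0}) i
  have hs : ContDiffOn ℝ 1 (fun x => ∑ j, pderiv j u x ^ 2) {x | x ≠ 0} :=
    ContDiffOn.sum fun j _ => (hp j).pow 2
  exact ((contDiffOn_const.mul hu1.exp).mul
    (hs.add ((contDiffOn_const.mul hr).add (contDiffOn_const.mul hu1).exp))).mul
    ((hp i).add (hx.mul hr))

lemma pderiv_exp {f : EuclideanSpace ℝ (Fin 3) → ℝ} {x : EuclideanSpace ℝ (Fin 3)}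
    (hf : DifferentiableAt ℝ f x) (i : Fin 3) :
    pderiv i (fun y => Real.exp (f y)) x = Real.exp (f x) * pderiv i f x := by
  rw [pderiv_comp Real.differentiableAt_exp hf, Real.deriv_exp]

lemma pderiv_inv_norm_sq {x : EuclideanSpace ℝ (Fin 3)} (hx : x ≠ 0) (i : Fin 3) :
    pderiv i (fun y : EuclideanSpace ℝ (Fin 3) => (‖y‖ ^ 2)⁻¹) x
      = -2 * x i * ((‖x‖ ^ 2)⁻¹) ^ 2 := by
  rw [pderiv_comp (h := fun t => t⁻¹) (f := fun y => ‖y‖ ^ 2)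
    (differentiableAt_inv (by simpa using hx))
    ((contDiff_norm_sq ℝ).differentiable one_ne_zero _), pderiv_norm_sq, deriv_inv]
  field_simp

lemma pderiv_auxField (hu : ContDiffOn ℝ 2 u {x | x ≠ 0}) {x : EuclideanSpace ℝ (Fin 3)}
    (hx : x ≠ 0) (i : Fin 3) :
    pderiv i (auxField k u i) x = 2⁻¹ * Real.exp (u x) *
      (pderiv i u x * ((∑ j, pderiv j u x ^ 2) + (k * (‖x‖ ^ 2)⁻¹ + Real.exp (-2 * u x)))
          * (pderiv i u x + x i * (‖x‖ ^ 2)⁻¹)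
        + (2 * (∑ j, pderiv j u x * pderiv i (pderiv j u) x)
            - 2 * k * ((‖x‖ ^ 2)⁻¹) ^ 2 * x i - 2 * Real.exp (-2 * u x) * pderiv i u x)
          * (pderiv i u x + x i * (‖x‖ ^ 2)⁻¹)
        + ((∑ j, pderiv j u x ^ 2) + (k * (‖x‖ ^ 2)⁻¹ + Real.exp (-2 * u x)))
          * (pderiv i (pderiv i u) x + (‖x‖ ^ 2)⁻¹ - 2 * x i ^ 2 * ((‖x‖ ^ 2)⁻¹) ^ 2)) := by
  have hU : {x : EuclideanSpace ℝ (Fin 3) | x ≠ 0} ∈ 𝓝 x := isOpen_setOf_ne_zero.mem_nhds hx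
  have hu0 : DifferentiableAt ℝ u x := (hu.contDiffAt hU).differentiableAt two_ne_zero
  have hp (j : Fin 3) : DifferentiableAt ℝ (pderiv j u) x :=
    ((contDiffOn_pderiv hu j).contDiffAt hU).differentiableAt one_ne_zero
  have hr : DifferentiableAt ℝ (fun y : EuclideanSpace ℝ (Fin 3) => (‖y‖ ^ 2)⁻¹) x :=
    ((contDiffOn_inv_norm_sq (n := 1)).contDiffAt hU).differentiableAt one_ne_zero
  have hxi : DifferentiableAt ℝ (fun y : EuclideanSpace ℝ (Fin 3) => y i) x :=
    ((contDiffOn_coord (n := 1) i).contDiffAt hU).differentiableAt one_ne_zero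
  have hc (c : ℝ) : DifferentiableAt ℝ (fun _ : EuclideanSpace ℝ (Fin 3) => c) x :=
    differentiableAt_const c
  have hpp (j : Fin 3) : DifferentiableAt ℝ (fun y => pderiv j u y * pderiv j u y) x :=
    (hp j).mul (hp j)
  have hs : DifferentiableAt ℝ (fun y => ∑ j, pderiv j u y * pderiv j u y) x :=
    DifferentiableAt.fun_sum fun j _ => hpp j
  have h2u : DifferentiableAt ℝ (fun y => -2 * u y) x := (hc _).mul hu0
  have hm : DifferentiableAt ℝ (fun y => k * (‖y‖ ^ 2)⁻¹ + Real.exp (-2 * u y)) x :=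
    ((hc k).mul hr).add h2u.exp
  unfold auxField
  simp only [pow_two (pderiv _ u _)]
  rw [pderiv_mul (((hc _).fun_mul hu0.exp).fun_mul (hs.fun_add hm))
      ((hp i).fun_add (hxi.fun_mul hr)),
    pderiv_mul ((hc _).fun_mul hu0.exp) (hs.fun_add hm), pderiv_mul (hc _) hu0.exp, pderiv_const,
    pderiv_exp hu0, pderiv_add hs hm, pderiv_sum fun j _ => hpp j,
    pderiv_add ((hc k).fun_mul hr) h2u.exp, pderiv_mul (hc _) hr, pderiv_const, pderiv_exp h2u,
    pderiv_mul (hc _) hu0, pderiv_const, pderiv_add (hp i) (hxi.fun_mul hr), pderiv_mul hxi hr,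
    pderiv_coord, pderiv_inv_norm_sq hx]
  simp only [fun j => pderiv_mul (i := i) (hp j) (hp j), ← two_mul, ← Finset.mul_sum, if_true]
  ring

/-- A solution `u = log ‖x‖ - v` of the lifted Liouville equation, with `v` homogeneous of degree
zero, is radial on the sphere of squared radius two. -/
lemma pderiv_eq_of_liouville (hk : 0 < k) (hu : ContDiffOn ℝ 2 u {x | x ≠ 0})
    (heuler : ∀ x ≠ 0, ∑ i, x i * pderiv i u x = 1)
    (hlap : ∀ x ≠ 0, ∑ i, pderiv i (pderiv i u) x = k * (‖x‖ ^ 2)⁻¹ + Real.exp (-2 * u x))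
    {x : EuclideanSpace ℝ (Fin 3)} (hx : ‖x‖ ^ 2 = 2) (i : Fin 3) :
    pderiv i u x = x i * (‖x‖ ^ 2)⁻¹ := by
  let b : ContDiffBump (2 : ℝ) := ⟨1 / 4, 1 / 2, by norm_num, by norm_num⟩
  let c : ContDiffBump (2 : ℝ) := ⟨3 / 4, 1, by norm_num, by norm_num⟩
  let φ : EuclideanSpace ℝ (Fin 3) → ℝ := radialBump b
  let χ : EuclideanSpace ℝ (Fin 3) → ℝ := radialBump c
  have hφ : ContDiff ℝ 1 φ := contDiff_radialBump b (n := 1)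
  have hχ : ContDiff ℝ 1 χ := contDiff_radialBump c (n := 1)
  have hφc : HasCompactSupport φ := hasCompactSupport_radialBump b
  have hχc : HasCompactSupport χ := hasCompactSupport_radialBump c
  have hφU : tsupport φ ⊆ {x | x ≠ 0} :=
    tsupport_radialBump_subset_ne_zero b (show (1 / 2 : ℝ) < 2 by norm_num)
  have hχU : tsupport χ ⊆ {x | x ≠ 0} :=
    tsupport_radialBump_subset_ne_zero c (show (1 : ℝ) < 2 by norm_num)
  have hφ0 (y) : 0 ≤ φ y := b.nonneg
  have hχ1 {y} (hy : y ∈ tsupport φ) : χ =ᶠ[𝓝 y] fun _ => 1 := by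
    have h : ‖y‖ ^ 2 ∈ Metric.ball (2 : ℝ) c.rIn :=
      Metric.closedBall_subset_ball (show (1 / 2 : ℝ) < 3 / 4 by norm_num)
        (tsupport_radialBump_subset b hy)
    exact (show ContinuousAt (fun y : EuclideanSpace ℝ (Fin 3) => ‖y‖ ^ 2) y by fun_prop).eventually
      (c.eventuallyEq_one_of_mem_ball h)
  have hp := contDiffOn_pderiv hu
  have hu1 : ContDiffOn ℝ 1 u {x | x ≠ 0} := hu.of_le (by norm_num)
  have hmul {h : EuclideanSpace ℝ (Fin 3) → ℝ} (hh : ContDiffOn ℝ 1 h {x | x ≠ 0}) :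
      ContDiff ℝ 1 (fun x => φ x * h x) :=
    hφ.mul_of_tsupport_subset isOpen_setOf_ne_zero hφU hh
  let G (i : Fin 3) (x : EuclideanSpace ℝ (Fin 3)) : ℝ := Real.exp (u x) * pderiv i u x
  let F (i : Fin 3) (x : EuclideanSpace ℝ (Fin 3)) : ℝ := φ x * G i x
  let g (i : Fin 3) (x : EuclideanSpace ℝ (Fin 3)) : ℝ := χ x * pderiv i u x
  let H (i : Fin 3) (x : EuclideanSpace ℝ (Fin 3)) : ℝ := φ x * auxField k u i x
  let j₀ (x : EuclideanSpace ℝ (Fin 3)) : ℝ := Real.exp (u x) * k * (‖x‖ ^ 2)⁻¹ *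
    ∑ i, (pderiv i u x - x i * (‖x‖ ^ 2)⁻¹) ^ 2
  let J (x : EuclideanSpace ℝ (Fin 3)) : ℝ := φ x * j₀ x
  have hG (i) : ContDiffOn ℝ 1 (G i) {x | x ≠ 0} := hu1.exp.mul (hp i)
  have hF (i) : ContDiff ℝ 1 (F i) := hmul (hG i)
  have hg (i) : ContDiff ℝ 1 (g i) :=
    hχ.mul_of_tsupport_subset isOpen_setOf_ne_zero hχU (hp i)
  have hH (i) : ContDiff ℝ 1 (H i) := hmul (contDiffOn_auxField hu i)
  have hJ : ContDiff ℝ 1 J := hmul <| ((hu1.exp.mul contDiffOn_const).mul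
      (contDiffOn_inv_norm_sq (n := 1))).mul <| ContDiffOn.sum fun i _ =>
    ((hp i).sub ((contDiffOn_coord (n := 1) i).mul (contDiffOn_inv_norm_sq (n := 1)))).pow 2
  have hFc (i) : HasCompactSupport (F i) := hφc.mul_right
  have hgc (i) : HasCompactSupport (g i) := hχc.mul_right
  have hHc (i) : HasCompactSupport (H i) := hφc.mul_right
  have hJc : HasCompactSupport J := hφc.mul_right
  have hcont {h : EuclideanSpace ℝ (Fin 3) → ℝ} (hh : ContDiff ℝ 1 h) (k : Fin 3) :
      Continuous (pderiv k h) :=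
    (ContDiff.pderiv (n := 0) (by simpa using hh)).continuous
  have hint1 (i j l n : Fin 3) : Integrable (fun x => pderiv i (F j) x * pderiv l (g n) x) :=
    ((hcont (hF j) i).mul (hcont (hg n) l)).integrable_of_hasCompactSupport
      (hFc j).pderiv.mul_right
  have hint2 (i : Fin 3) : Integrable (pderiv i (H i)) :=
    (hcont (hH i) i).integrable_of_hasCompactSupport (hHc i).pderiv
  have hint3 (i j : Fin 3) : Integrable
      (fun x => pderiv j (F i) x * pderiv i (g j) x - pderiv i (F i) x * pderiv j (g j) x) :=
    (hint1 j i i j).sub (hint1 i i j j)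
  let I (x : EuclideanSpace ℝ (Fin 3)) : ℝ :=
    (∑ i, ∑ j, (pderiv j (F i) x * pderiv i (g j) x - pderiv i (F i) x * pderiv j (g j) x))
      + ∑ i, pderiv i (H i) x
  have hI1 : Integrable (fun x => ∑ i, ∑ j,
      (pderiv j (F i) x * pderiv i (g j) x - pderiv i (F i) x * pderiv j (g j) x)) :=
    integrable_finsetSum _ fun i _ => integrable_finsetSum _ fun j _ => hint3 i j
  have hI2 : Integrable (fun x => ∑ i, pderiv i (H i) x) :=
    integrable_finsetSum _ fun i _ => hint2 i
  have hI0 : ∫ x, I x = 0 := by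
    rw [integral_add hI1 hI2, integral_finsetSum _ fun i _ => hint2 i,
      integral_finsetSum _ fun i _ => integrable_finsetSum _ fun j _ => hint3 i j]
    simp only [integral_pderiv_eq_zero (hH _) (hHc _), Finset.sum_const_zero, add_zero]
    refine Finset.sum_eq_zero fun i _ => ?_
    rw [integral_finsetSum _ fun j _ => hint3 i j]
    refine Finset.sum_eq_zero fun j _ => ?_
    rw [integral_sub (hint1 j i i j) (hint1 i i j j),
      integral_pderiv_mul_pderiv_comm (hF i) (hFc i) (hg j) (hgc j), sub_self]
  have hJI (y) : J y ≤ I y := by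
    by_cases hy : y ∈ tsupport φ
    · have hy0 : y ≠ 0 := hφU hy
      have hU : {x : EuclideanSpace ℝ (Fin 3) | x ≠ 0} ∈ 𝓝 y :=
        isOpen_setOf_ne_zero.mem_nhds hy0
      have hd {h : EuclideanSpace ℝ (Fin 3) → ℝ} (hh : ContDiffOn ℝ 1 h {x | x ≠ 0}) :
          DifferentiableAt ℝ h y := (hh.contDiffAt hU).differentiableAt one_ne_zero
      have hφd : DifferentiableAt ℝ φ y := hφ.differentiable one_ne_zero y
      have hdφ (i : Fin 3) : pderiv i φ y = 2 * deriv b (‖y‖ ^ 2) * y i := pderiv_radialBump b y i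
      have hdg (i j : Fin 3) : pderiv i (g j) y = pderiv i (pderiv j u) y := by
        refine EventuallyEq.pderiv_eq ?_
        filter_upwards [hχ1 hy] with z hz
        simp [g, hz]
      have hdF (i j : Fin 3) : pderiv j (F i) y =
          φ y * (Real.exp (u y) * (pderiv j (pderiv i u) y + pderiv i u y * pderiv j u y))
          + Real.exp (u y) * pderiv i u y * (2 * deriv b (‖y‖ ^ 2) * y j) := by
        simp only [F, G]
        rw [pderiv_mul hφd (hd (hG i)), pderiv_mul (hd hu1).exp (hd (hp i)), pderiv_exp (hd hu1),
          hdφ]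
        ring
      have hdH (i : Fin 3) : pderiv i (H i) y = φ y * pderiv i (auxField k u i) y
          + auxField k u i y * (2 * deriv b (‖y‖ ^ 2) * y i) := by
        simp only [H]
        rw [pderiv_mul hφd (hd (contDiffOn_auxField hu i)), hdφ]
      have hsymm (i j : Fin 3) : pderiv i (pderiv j u) y = pderiv j (pderiv i u) y :=
        pderiv_comm (hu.contDiffAt hU)
      have hR : (∑ i, y i ^ 2) * (‖y‖ ^ 2)⁻¹ = 1 := by
        rw [← EuclideanSpace.real_norm_sq_eq, mul_inv_cancel₀ (by simpa using hy0)]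
      have hXA (j : Fin 3) : pderiv j u y + ∑ i, y i * pderiv i (pderiv j u) y = 0 := by
        have h1 : (fun z => ∑ i, z i * pderiv i u z) =ᶠ[𝓝 y] fun _ => 1 := by
          filter_upwards [hU] with z hz using heuler z hz
        have h2 := h1.pderiv_eq (i := j)
        rw [pderiv_const, pderiv_sum fun i _ =>
          (hd (contDiffOn_coord (n := 1) i)).fun_mul (hd (hp i))] at h2
        simp only [fun i => pderiv_mul (i := j) (hd (contDiffOn_coord (n := 1) i)) (hd (hp i)),
          pderiv_coord] at h2
        simp only [Finset.sum_add_distrib, mul_ite, mul_one, mul_zero, Finset.sum_ite_eq',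
          Finset.mem_univ, if_true] at h2
        simp only [hsymm _ j]
        linarith
      have key := divergence_identity (φ y) (2 * deriv b (‖y‖ ^ 2)) (Real.exp (u y)) k
        ((‖y‖ ^ 2)⁻¹) (k * (‖y‖ ^ 2)⁻¹ + Real.exp (-2 * u y)) y (fun i => pderiv i u y)
        (fun i j => pderiv i (pderiv j u) y) hR (heuler y hy0) hXA hsymm (hlap y hy0)
      have hI : I y = φ y * Real.exp (u y) *
          ((∑ i, ∑ j, (pderiv i (pderiv j u) y + pderiv i u y * pderiv j u y) ^ 2
              - (∑ i, (pderiv i (pderiv i u) y + pderiv i u y * pderiv i u y)) ^ 2 / 2)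
            + k * (‖y‖ ^ 2)⁻¹ * ∑ i, (pderiv i u y - y i * (‖y‖ ^ 2)⁻¹) ^ 2) := by
        rw [← key]
        simp only [I, hdF, hdg, hdH, pderiv_auxField hu hy0]
        congr 1
        · refine Finset.sum_congr rfl fun i _ => Finset.sum_congr rfl fun j _ => ?_
          rw [hsymm j i]
        · refine Finset.sum_congr rfl fun i _ => ?_
          simp only [fun j => hsymm j i, auxField]
          ring
      have hT := half_sq_trace_le ((‖y‖ ^ 2)⁻¹) y
        (fun i j => pderiv i (pderiv j u) y + pderiv i u y * pderiv j u y) hR (by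
          have h0 (j : Fin 3) :
              ∑ i, y i * (pderiv i (pderiv j u) y + pderiv i u y * pderiv j u y) = 0 := by
            simp only [mul_add, Finset.sum_add_distrib, ← mul_assoc, ← Finset.sum_mul,
              heuler y hy0]
            linarith [hXA j]
          rw [Finset.sum_comm]
          simp only [← Finset.sum_mul, h0, zero_mul, Finset.sum_const_zero])
      have := mul_nonneg (mul_nonneg (hφ0 y) (Real.exp_pos (u y)).le) hT
      rw [hI]
      simp only [J, j₀]
      linarith
    · have h0 {h : EuclideanSpace ℝ (Fin 3) → ℝ} (i : Fin 3) :
          pderiv i (fun x => φ x * h x) y = 0 := by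
        rw [← pderiv_const (x := y) (i := i) 0]
        refine EventuallyEq.pderiv_eq ?_
        filter_upwards [notMem_tsupport_iff_eventuallyEq.1 hy] with z hz
        simp [hz]
      have hφy : φ y = 0 := image_eq_zero_of_notMem_tsupport hy
      simp [I, J, F, H, h0, hφy]
  have hJ0 : 0 ≤ J := fun y => mul_nonneg (hφ0 y) (by positivity)
  have hJx : J x = 0 := by
    by_contra hne
    have h1 := hJ.continuous.integral_pos_of_hasCompactSupport_nonneg_nonzero
      (μ := (volume : Measure (EuclideanSpace ℝ (Fin 3)))) hJc hJ0 hne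
    have h2 := integral_mono (hJ.continuous.integrable_of_hasCompactSupport hJc)
      (hI1.add hI2) hJI
    linarith [hI0.symm.le, hI0.le, h2.trans_eq hI0]
  have hφx : φ x = 1 := by
    change b (‖x‖ ^ 2) = 1
    rw [hx]
    exact b.one_of_mem_closedBall (Metric.mem_closedBall_self b.rIn_pos.le)
  have hsum : ∑ i, (pderiv i u x - x i * (‖x‖ ^ 2)⁻¹) ^ 2 = 0 := by
    simpa [J, j₀, hφx, hk.ne', show x ≠ 0 by rintro rfl; simp at hx] using hJx
  have := (Finset.sum_eq_zero_iff_of_nonneg fun i _ => sq_nonneg _).1 hsum i (Finset.mem_univ i)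
  exact sub_eq_zero.1 (pow_eq_zero_iff two_ne_zero |>.1 this)

end Rigidity

section Homogeneous

open Filter Topology

variable {m : ℕ} {f : EuclideanSpace ℝ (Fin m) → ℝ} {t c : ℝ}

lemma pderiv_smul_of_scaling (ht : t ≠ 0) (h : ∀ y, f (t • y) = c * f y) (i : Fin m)
    (x : EuclideanSpace ℝ (Fin m)) : pderiv i f (t • x) = t⁻¹ * c * pderiv i f x := by
  have h1 := pderiv_comp_smul (f := f) (i := i) (x := x) t
  have h2 : pderiv i (fun y => c * f y) x = c * pderiv i f x := by
    change fderiv ℝ (c • f) x _ = _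
    rw [fderiv_const_smul_field]
    rfl
  simp only [h, h2] at h1
  rw [mul_assoc, h1, inv_mul_cancel_left₀ ht]

lemma sum_mul_pderiv_eq_zero {x : EuclideanSpace ℝ (Fin m)} (hf : DifferentiableAt ℝ f x)
    (h : ∀ t : ℝ, 0 < t → f (t • x) = f x) : ∑ i, x i * pderiv i f x = 0 := by
  rw [← fderiv_apply_eq_sum_pderiv]
  have h1 : HasDerivAt (fun t : ℝ => t • x) x 1 := by
    simpa using (hasDerivAt_id (1 : ℝ)).smul_const x
  have h2 : HasDerivAt (fun t : ℝ => f (t • x)) (fderiv ℝ f x x) 1 := by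
    refine HasFDerivAt.comp_hasDerivAt (1 : ℝ) ?_ h1
    simpa using hf.hasFDerivAt
  refine h2.unique ((hasDerivAt_const (1 : ℝ) (f x)).congr_of_eventuallyEq ?_)
  filter_upwards [lt_mem_nhds one_pos] with t ht using h t ht

end Homogeneous

theorem stmt16 (β : ℝ) (hβ1 : 0 < β) (hβ2 : β < 1)
    (v : EuclideanSpace ℝ (Fin 3) → ℝ)
    (hv : ContDiffOn ℝ 2 (fun x => v (‖x‖⁻¹ • x)) {x | x ≠ 0})
    (heq : ∀ θ ∈ Metric.sphere (0 : EuclideanSpace ℝ (Fin 3)) 1,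
      -sphLaplacian v θ + β = Real.exp (2 * v θ)) :
    ∀ θ ∈ Metric.sphere (0 : EuclideanSpace ℝ (Fin 3)) 1,
      ∀ θ' ∈ Metric.sphere (0 : EuclideanSpace ℝ (Fin 3)) 1, v θ = v θ' := by
  set V : EuclideanSpace ℝ (Fin 3) → ℝ := fun x => v (‖x‖⁻¹ • x) with hVdef
  have hV0 {t : ℝ} (ht : 0 < t) (y) : V (t • y) = 1 * V y := by
    simp only [hVdef, norm_smul, Real.norm_eq_abs, abs_of_pos ht, smul_smul, one_mul]
    congr 2
    field_simp
  have hV1 {t : ℝ} (ht : 0 < t) (i) (y) : pderiv i V (t • y) = t⁻¹ * pderiv i V y := by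
    rw [pderiv_smul_of_scaling ht.ne' (hV0 ht), mul_one]
  have hV2 {t : ℝ} (ht : 0 < t) (i) (y) :
      pderiv i (pderiv i V) (t • y) = (t ^ 2)⁻¹ * pderiv i (pderiv i V) y := by
    rw [pderiv_smul_of_scaling ht.ne' (hV1 ht i), ← mul_inv, pow_two]
  have hU {x : EuclideanSpace ℝ (Fin 3)} (hx : x ≠ 0) :
      {x : EuclideanSpace ℝ (Fin 3) | x ≠ 0} ∈ nhds x := isOpen_setOf_ne_zero.mem_nhds hx
  have hlapV {x : EuclideanSpace ℝ (Fin 3)} (hx : x ≠ 0) :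
      ∑ i, pderiv i (pderiv i V) x = (‖x‖ ^ 2)⁻¹ * (β - Real.exp (2 * V x)) := by
    have hn : 0 < ‖x‖ := norm_pos_iff.2 hx
    have hθ : ‖‖x‖⁻¹ • x‖ = 1 := by rw [norm_smul, norm_inv, norm_norm, inv_mul_cancel₀ hn.ne']
    have hθ0 : ‖x‖⁻¹ • x ≠ 0 := norm_ne_zero_iff.1 (by rw [hθ]; exact one_ne_zero)
    have h := heq (‖x‖⁻¹ • x) (by simpa using hθ)
    rw [sphLaplacian, eLaplacian_eq_sum_pderiv (hv.contDiffAt (hU hθ0))] at h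
    have hx' : x = ‖x‖ • ‖x‖⁻¹ • x := by rw [smul_inv_smul₀ hn.ne']
    conv_lhs => rw [hx']
    simp only [hV2 hn, ← Finset.mul_sum]
    congr 1
    simp only [hVdef] at h ⊢
    linarith
  have hd0 {x} (hx : x ≠ 0) : DifferentiableAt ℝ V x :=
    (hv.contDiffAt (hU hx)).differentiableAt two_ne_zero
  have hd1 {x} (hx : x ≠ 0) (i) : DifferentiableAt ℝ (pderiv i V) x :=
    ((contDiffOn_pderiv hv i).contDiffAt (hU hx)).differentiableAt one_ne_zero
  set u : EuclideanSpace ℝ (Fin 3) → ℝ := fun x => 2⁻¹ * Real.log (‖x‖ ^ 2) - V x with hu_def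
  have hsq {x : EuclideanSpace ℝ (Fin 3)} (hx : x ≠ 0) : ‖x‖ ^ 2 ≠ 0 := by simpa using hx
  have hlog : ContDiffOn ℝ 2 (fun x : EuclideanSpace ℝ (Fin 3) => Real.log (‖x‖ ^ 2))
      {x | x ≠ 0} :=
    (contDiff_norm_sq ℝ).contDiffOn.log fun x hx => hsq hx
  have hu : ContDiffOn ℝ 2 u {x | x ≠ 0} := (contDiffOn_const.mul hlog).sub hv
  have hdsq (x : EuclideanSpace ℝ (Fin 3)) :
      DifferentiableAt ℝ (fun y : EuclideanSpace ℝ (Fin 3) => ‖y‖ ^ 2) x :=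
    (contDiff_norm_sq ℝ).differentiable one_ne_zero x
  have hpu {x : EuclideanSpace ℝ (Fin 3)} (hx : x ≠ 0) (i : Fin 3) :
      pderiv i u x = x i * (‖x‖ ^ 2)⁻¹ - pderiv i V x := by
    have hl : DifferentiableAt ℝ (fun y : EuclideanSpace ℝ (Fin 3) => Real.log (‖y‖ ^ 2)) x :=
      (hdsq x).log (hsq hx)
    rw [hu_def, pderiv_sub ((differentiableAt_const _).fun_mul hl) (hd0 hx),
      pderiv_mul (differentiableAt_const _) hl, pderiv_const,
      pderiv_comp (Real.differentiableAt_log (hsq hx)) (hdsq x), pderiv_norm_sq, Real.deriv_log]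
    ring
  have hppu {x : EuclideanSpace ℝ (Fin 3)} (hx : x ≠ 0) (i : Fin 3) :
      pderiv i (pderiv i u) x
        = (‖x‖ ^ 2)⁻¹ - 2 * x i ^ 2 * ((‖x‖ ^ 2)⁻¹) ^ 2 - pderiv i (pderiv i V) x := by
    have hev : pderiv i u =ᶠ[nhds x] fun y => y i * (‖y‖ ^ 2)⁻¹ - pderiv i V y := by
      filter_upwards [hU hx] with y hy using hpu hy i
    have hc : DifferentiableAt ℝ (fun y : EuclideanSpace ℝ (Fin 3) => y i) x :=
      ((contDiffOn_coord (n := 1) i).contDiffAt (hU hx)).differentiableAt one_ne_zero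
    have hr : DifferentiableAt ℝ (fun y : EuclideanSpace ℝ (Fin 3) => (‖y‖ ^ 2)⁻¹) x :=
      (hdsq x).fun_inv (hsq hx)
    rw [hev.pderiv_eq, pderiv_sub (hc.fun_mul hr) (hd1 hx i), pderiv_mul hc hr, pderiv_coord,
      pderiv_inv_norm_sq hx, if_pos rfl]
    ring
  have hρ {x : EuclideanSpace ℝ (Fin 3)} (hx : x ≠ 0) : (∑ i, x i ^ 2) * (‖x‖ ^ 2)⁻¹ = 1 := by
    rw [← EuclideanSpace.real_norm_sq_eq, mul_inv_cancel₀ (hsq hx)]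
  have heuler : ∀ x ≠ 0, ∑ i, x i * pderiv i u x = 1 := by
    intro x hx
    have h := sum_mul_pderiv_eq_zero (hd0 hx) fun t ht => by rw [hV0 ht, one_mul]
    simp only [hpu hx, mul_sub, Finset.sum_sub_distrib, h, sub_zero, ← mul_assoc, ← pow_two,
      ← Finset.sum_mul, hρ hx]
  have hlap : ∀ x ≠ 0, ∑ i, pderiv i (pderiv i u) x
      = (1 - β) * (‖x‖ ^ 2)⁻¹ + Real.exp (-2 * u x) := by
    intro x hx
    have hexp : Real.exp (-2 * u x) = (‖x‖ ^ 2)⁻¹ * Real.exp (2 * V x) := by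
      rw [hu_def, show -2 * (2⁻¹ * Real.log (‖x‖ ^ 2) - V x) = -Real.log (‖x‖ ^ 2) + 2 * V x by ring,
        Real.exp_add, Real.exp_neg, Real.exp_log ((sq_nonneg _).lt_of_ne' (hsq hx))]
    simp only [hppu hx, Finset.sum_sub_distrib, hlapV hx, ← Finset.sum_mul, ← Finset.mul_sum, hexp]
    simp only [Finset.sum_const, Finset.card_univ, Fintype.card_fin, nsmul_eq_mul]
    push_cast
    linear_combination (-2 * (‖x‖ ^ 2)⁻¹) * hρ hx
  have hzero {x : EuclideanSpace ℝ (Fin 3)} (hx : x ≠ 0) (i : Fin 3) : pderiv i V x = 0 := by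
    have hn : 0 < ‖x‖ := norm_pos_iff.2 hx
    have ht : 0 < √2 / ‖x‖ := by positivity
    have hy : ‖(√2 / ‖x‖) • x‖ ^ 2 = 2 := by
      rw [norm_smul, Real.norm_of_nonneg ht.le, div_mul_cancel₀ _ hn.ne', Real.sq_sqrt zero_le_two]
    have h := pderiv_eq_of_liouville (sub_pos.2 hβ2) hu heuler hlap hy i
    rw [hpu (smul_ne_zero ht.ne' hx), hV1 ht] at h
    simpa [ht.ne', hx] using h
  have hfd : Set.EqOn (fderiv ℝ V) 0 {x | x ≠ 0} := fun x hx => by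
    ext w
    simp [fderiv_apply_eq_sum_pderiv, hzero hx]
  have hconn : IsPreconnected {x : EuclideanSpace ℝ (Fin 3) | x ≠ 0} :=
    (isConnected_compl_singleton_of_one_lt_rank
      (by rw [← Module.finrank_eq_rank]; simp) 0).isPreconnected
  intro θ hθ θ' hθ'
  have hne {z : EuclideanSpace ℝ (Fin 3)} (hz : z ∈ Metric.sphere 0 1) : z ≠ 0 :=
    ne_zero_of_mem_unit_sphere ⟨z, hz⟩
  have h := isOpen_setOf_ne_zero.is_const_of_fderiv_eq_zero hconn
    (fun x hx => (hd0 hx).differentiableWithinAt) hfd (hne hθ) (hne hθ')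
  simpa [hVdef, mem_sphere_zero_iff_norm.1 hθ, mem_sphere_zero_iff_norm.1 hθ'] using h
end
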